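/- Let λ ∈ ℝⁿ be weakly decreasing, with distinct values of multiplicities m₁, …, m_r (so m₁ + ⋯ + m_r = n), and set d := (n² − Σ_{j=1}^{r} m_j²)/2. Then the space O_λ^{≥0}, equipped with the subspace topology from the space of n×n complex matrices, is homeomorphic to the closed unit ball of ℝ^d via a homeomorphism carrying O_λ^{>0} onto the open unit ball; consequently, O_λ^{>0} is homeomorphic to an open d-dimensional ball, and if λ is nonconstant then O_λ^{≥0} ∖ O_λ^{>0} is homeomorphic to the sphere S^{d−1}. -/

import Mathlib

open Matrix Finset

/-- The minor of a square matrix `g` on row set `I` and column set `J`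
(rows and columns listed in increasing order); defined to be `0` if `I` and `J`
have different cardinalities. -/
noncomputable def minorOn {R : Type} [CommRing R] {n : ℕ} (g : Matrix (Fin n) (Fin n) R)
    (I J : Finset (Fin n)) : R :=
  if h : J.card = I.card then
    Matrix.det (Matrix.of fun a b : Fin I.card =>
      g ((I.orderIsoOfFin rfl a : Fin n)) ((J.orderIsoOfFin h b : Fin n)))
  else 0

/-- The left-justified minor `Δ_I(g)`: the minor on rows `I` and the first `|I|` columns. -/
noncomputable def leftMinor {R : Type} [CommRing R] {n : ℕ} (g : Matrix (Fin n) (Fin n) R)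
    (I : Finset (Fin n)) : R :=
  minorOn g I (Finset.univ.filter fun j : Fin n => (j : ℕ) < I.card)

/-- A complex number is a positive real. -/
def IsPosReal (z : ℂ) : Prop := 0 < z.re ∧ z.im = 0

/-- A complex number is a nonnegative real. -/
def IsNonnegReal (z : ℂ) : Prop := 0 ≤ z.re ∧ z.im = 0

/-- The diagonal sign matrix `δ_n = diag(1, −1, 1, …, (−1)^{n−1})`. -/
noncomputable def deltaMat (n : ℕ) : Matrix (Fin n) (Fin n) ℂ :=
  Matrix.diagonal fun i : Fin n => (-1 : ℂ) ^ (i : ℕ)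

/-- The totally positive part `U_n^{>0}` of the unitary group: unitary matrices all of
whose left-justified minors are positive real numbers. -/
def UnitaryTP (n : ℕ) : Set (Matrix (Fin n) (Fin n) ℂ) :=
  {g | g.conjTranspose * g = 1 ∧ ∀ I : Finset (Fin n), IsPosReal (leftMinor g I)}

/-- The totally positive part `O_λ^{>0}` of the adjoint orbit: Hermitian matrices
`g · diag(λ) · g*` with `g ∈ U_n^{>0}`. -/
def OrbitTP {n : ℕ} (lam : Fin n → ℝ) : Set (Matrix (Fin n) (Fin n) ℂ) :=
  {L | ∃ g ∈ UnitaryTP n,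
    L = g * Matrix.diagonal (fun i => (lam i : ℂ)) * g.conjTranspose}

/-- The totally nonnegative part `O_λ^{≥0}`: the closure of `O_λ^{>0}` in the space of
`n×n` complex matrices. -/
noncomputable def OrbitTNN {n : ℕ} (lam : Fin n → ℝ) : Set (Matrix (Fin n) (Fin n) ℂ) :=
  closure (OrbitTP lam)


/-- Unsorted Cauchy–Binet. -/
theorem cb_unsorted {R : Type} [CommRing R] {n k : ℕ} (A : Matrix (Fin k) (Fin n) R)
    (B : Matrix (Fin n) (Fin k) R) :
    (k.factorial : R) * (A * B).det =
      ∑ f : Fin k → Fin n, (A.submatrix id f).det * (B.submatrix f id).det := by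
  have h1 : (A * B).det = ∑ f : Fin k → Fin n, (∏ i, A i (f i)) * (B.submatrix f id).det := by
    have : (A * B) = fun i => ∑ m : Fin n, A i m • B m := by
      ext i j
      simp [Matrix.mul_apply, Finset.sum_apply]
    rw [this]
    change Matrix.detRowAlternating.toMultilinearMap _ = _
    rw [MultilinearMap.map_sum]
    refine Finset.sum_congr rfl fun f _ => ?_
    rw [MultilinearMap.map_smul_univ]
    rfl
  have h2 : ∀ σ : Equiv.Perm (Fin k), (A * B).det =
      ∑ f : Fin k → Fin n, (Equiv.Perm.sign σ : R) * (∏ i, A i (f (σ i))) * (B.submatrix f id).det := by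
    intro σ
    rw [h1]
    rw [← (Equiv.arrowCongr σ.symm (Equiv.refl (Fin n))).sum_comp]
    refine Finset.sum_congr rfl fun f _ => ?_
    have : (B.submatrix ((Equiv.arrowCongr σ.symm (Equiv.refl (Fin n))) f) id)
      = (B.submatrix f id).submatrix σ id := by
      ext i j; simp [Equiv.arrowCongr]
    rw [this, Matrix.det_permute]
    simp [Equiv.arrowCongr]
    ring
  have h3 : (k.factorial : R) * (A * B).det = ∑ σ : Equiv.Perm (Fin k), (A * B).det := by
    simp [Finset.card_univ, Fintype.card_perm]
  rw [h3, Finset.sum_congr rfl (fun σ _ => h2 σ), Finset.sum_comm]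
  refine Finset.sum_congr rfl fun f _ => ?_
  rw [← Finset.sum_mul]
  congr 1
  rw [← Matrix.det_transpose, Matrix.det_apply']
  refine Finset.sum_congr rfl fun σ _ => ?_
  simp

theorem sort_minor {n k : ℕ} (f : Fin k → Fin n) :
    (¬ Function.Injective f) ∨ ∃ f' : Fin k → Fin n, StrictMono f' ∧
      ∃ s : ℤˣ, ∀ {R : Type} [CommRing R] (A : Matrix (Fin n) (Fin k) R),
        (A.submatrix f id).det = (s : R) * (A.submatrix f' id).det := by
  by_cases hf : Function.Injective f
  · right
    refine ⟨f ∘ Tuple.sort f, ?_, Equiv.Perm.sign (Tuple.sort f), ?_⟩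
    · exact (Tuple.monotone_sort f).strictMono_of_injective
        (hf.comp (Tuple.sort f).injective)
    · intro R _ A
      have : A.submatrix (f ∘ Tuple.sort f) id = (A.submatrix f id).submatrix (Tuple.sort f) id := rfl
      rw [this, Matrix.det_permute, ← mul_assoc]
      have h := Int.units_mul_self (Equiv.Perm.sign (Tuple.sort f))
      have h' : ((Equiv.Perm.sign (Tuple.sort f) : ℤ) : R) * ((Equiv.Perm.sign (Tuple.sort f) : ℤ) : R) = 1 := by
        rw [← Int.cast_mul, ← Units.val_mul, h]; simp
      rw [h', one_mul]
  · left; exact hf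

theorem minor_noninj {R : Type} [CommRing R] {n k : ℕ} (A : Matrix (Fin n) (Fin k) R)
    (f : Fin k → Fin n) (hf : ¬ Function.Injective f) : (A.submatrix f id).det = 0 := by
  simp only [Function.Injective, not_forall] at hf
  obtain ⟨a, b, hab, hne⟩ := hf
  exact Matrix.det_zero_of_row_eq hne (by ext j; simp [hab])

/-- Positive left minors. -/
def PosL {n : ℕ} (g : Matrix (Fin n) (Fin n) ℝ) : Prop :=
  ∀ (k : ℕ) (h : k ≤ n) (f : Fin k → Fin n), StrictMono f →
    0 < (g.submatrix f (Fin.castLE h)).det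

/-- Nonnegative left minors. -/
def NonnegL {n : ℕ} (g : Matrix (Fin n) (Fin n) ℝ) : Prop :=
  ∀ (k : ℕ) (h : k ≤ n) (f : Fin k → Fin n), StrictMono f →
    0 ≤ (g.submatrix f (Fin.castLE h)).det

theorem PosL.nonneg {n : ℕ} {g : Matrix (Fin n) (Fin n) ℝ} (h : PosL g) : NonnegL g :=
  fun k hk f hf => (h k hk f hf).le

theorem leftMinor_eq {R : Type} [CommRing R] {n : ℕ} (g : Matrix (Fin n) (Fin n) R)
    (I : Finset (Fin n)) (hI : I.card ≤ n) :
    leftMinor g I = (g.submatrix (I.orderEmbOfFin rfl) (Fin.castLE hI)).det := by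
  have hc : (Finset.univ.filter fun j : Fin n => (j : ℕ) < I.card).card = I.card := by
    rw [Fin.card_filter_val_lt]; omega
  unfold leftMinor minorOn
  rw [dif_pos hc]
  congr 1
  ext a b
  have h2 : (Fin.castLE hI : Fin I.card → Fin n) = 
      (Finset.univ.filter fun j : Fin n => (j : ℕ) < I.card).orderEmbOfFin hc := by
    apply Finset.orderEmbOfFin_unique
    · intro x; simp
    · exact Fin.strictMono_castLE hI
  simp only [Matrix.of_apply, Matrix.submatrix_apply]
  rw [h2]
  rfl

theorem strictMono_leftMinor {R : Type} [CommRing R] {n k : ℕ} (g : Matrix (Fin n) (Fin n) R)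
    (hk : k ≤ n) (f : Fin k → Fin n) (hf : StrictMono f) :
    (g.submatrix f (Fin.castLE hk)).det = leftMinor g (Finset.univ.image f) := by
  have hc : (Finset.univ.image f).card = k := by
    rw [Finset.card_image_of_injective _ hf.injective]; simp
  rw [leftMinor_eq g _ (by omega)]
  have : ∀ (k' : ℕ) (e : (Finset.univ.image f).card = k') (hk' : k' ≤ n) , 
     (g.submatrix ((Finset.univ.image f).orderEmbOfFin rfl) (Fin.castLE (by omega))).det
      = (g.submatrix ((Finset.univ.image f).orderEmbOfFin e) (Fin.castLE hk')).det := by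
    intro k' e hk'
    subst e
    rfl
  rw [this k hc hk]
  congr 2
  apply Finset.orderEmbOfFin_unique
  · intro x; simp
  · exact hf

theorem exists_minor_ne_zero {n k : ℕ} (g : Matrix (Fin n) (Fin n) ℝ) (hg : g.det ≠ 0) (hk : k ≤ n) :
    ∃ f : Fin k → Fin n, StrictMono f ∧ (g.submatrix f (Fin.castLE hk)).det ≠ 0 := by
  by_contra hcon
  push Not at hcon
  have h0 : ∀ f : Fin k → Fin n, (g.submatrix f (Fin.castLE hk)).det = 0 := by
    intro f
    have : g.submatrix f (Fin.castLE hk) = (g.submatrix id (Fin.castLE hk)).submatrix f id := rfl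
    rw [this]
    rcases sort_minor f with h | ⟨f', hf', s, hs⟩
    · exact minor_noninj _ _ h
    · rw [hs]
      have := hcon f' hf'
      rw [show (g.submatrix id (Fin.castLE hk)).submatrix f' id = g.submatrix f' (Fin.castLE hk) from rfl, this, mul_zero]
  have h1 := cb_unsorted (g⁻¹.submatrix (Fin.castLE hk) id) (g.submatrix id (Fin.castLE hk))
  have h2 : g⁻¹.submatrix (Fin.castLE hk) id * g.submatrix id (Fin.castLE hk) = 1 := by
    have : g⁻¹.submatrix (Fin.castLE hk) id * g.submatrix id (Fin.castLE hk) = (g⁻¹ * g).submatrix (Fin.castLE hk) (Fin.castLE hk) := by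
      ext i j; simp [Matrix.mul_apply]
    rw [this, Matrix.nonsing_inv_mul _ (by simpa using hg)]
    exact Matrix.submatrix_one _ (Fin.castLE_injective hk)
  rw [h2] at h1
  have h3 : ∀ f : Fin k → Fin n, ((g.submatrix id (Fin.castLE hk)).submatrix f id).det = 0 := h0
  simp [h0] at h1
  exact Nat.factorial_ne_zero _ h1

/-- Leading minors of `Sᵀ g`. -/
theorem leading_minor_pos {n k : ℕ} (hk : k ≤ n) (S g : Matrix (Fin n) (Fin n) ℝ) (hS : PosL S)
    (hg : NonnegL g) (hdet : g.det ≠ 0) :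
    0 < ((Sᵀ * g).submatrix (Fin.castLE hk) (Fin.castLE hk)).det := by
  have h1 := cb_unsorted (Sᵀ.submatrix (Fin.castLE hk) id) (g.submatrix id (Fin.castLE hk))
  have h2 : Sᵀ.submatrix (Fin.castLE hk) id * g.submatrix id (Fin.castLE hk)
     = (Sᵀ * g).submatrix (Fin.castLE hk) (Fin.castLE hk) := by
    ext i j; simp [Matrix.mul_apply]
  rw [h2] at h1
  have e1 : ∀ f : Fin k → Fin n, ((Sᵀ.submatrix (Fin.castLE hk) id).submatrix id f).det = (S.submatrix f (Fin.castLE hk)).det := by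
    intro f
    rw [← Matrix.det_transpose]; rfl
  have e2 : ∀ f : Fin k → Fin n, ((g.submatrix id (Fin.castLE hk)).submatrix f id).det = (g.submatrix f (Fin.castLE hk)).det := fun f => rfl
  simp only [e1, e2] at h1
  have hpos : 0 < ∑ f : Fin k → Fin n, (S.submatrix f (Fin.castLE hk)).det * (g.submatrix f (Fin.castLE hk)).det := by
    obtain ⟨f0, hf0, hne⟩ := exists_minor_ne_zero g hdet hk
    apply Finset.sum_pos'
    · intro f _
      rcases sort_minor f with h | ⟨f', hf', s, hs⟩
      · have := minor_noninj (g.submatrix id (Fin.castLE hk)) f h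
        rw [e2] at this
        rw [this, mul_zero]
      · have hs1 := hs (g.submatrix id (Fin.castLE hk))
        have hs2 := hs (S.submatrix id (Fin.castLE hk))
        simp only [Matrix.submatrix_submatrix, Function.comp_id, Function.id_comp] at hs1 hs2
        rw [hs1, hs2]
        have : ((s:ℤ):ℝ) * ((s:ℤ):ℝ) = 1 := by
          rw [← Int.cast_mul, ← Units.val_mul, Int.units_mul_self]; simp
        have := mul_nonneg (hS k hk f' hf').le (hg k hk f' hf')
        nlinarith
    · exact ⟨f0, Finset.mem_univ _, mul_pos (hS k hk f0 hf0) (lt_of_le_of_ne (hg k hk f0 hf0) hne.symm)⟩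
  rw [← h1] at hpos
  exact pos_of_mul_pos_right hpos (by positivity)

/-- Right multiplication by an upper triangular matrix. -/
theorem minor_mul_upper {n k : ℕ} (hk : k ≤ n) (A T : Matrix (Fin n) (Fin n) ℝ)
    (hT : ∀ i j, j < i → T i j = 0) (f : Fin k → Fin n) :
    ((A * T).submatrix f (Fin.castLE hk)).det =
      (A.submatrix f (Fin.castLE hk)).det * ∏ i : Fin k, T (Fin.castLE hk i) (Fin.castLE hk i) := by
  have : (A * T).submatrix f (Fin.castLE hk) =
      A.submatrix f (Fin.castLE hk) * T.submatrix (Fin.castLE hk) (Fin.castLE hk) := by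
    ext i j
    simp only [Matrix.submatrix_apply, Matrix.mul_apply]
    symm
    rw [← Finset.sum_image (s := Finset.univ) (g := Fin.castLE hk) (f := fun x => A (f i) x * T x (Fin.castLE hk j))
      (fun a _ b _ h => Fin.castLE_injective hk h)]
    apply Finset.sum_subset (Finset.subset_univ _)
    intro x _ hx
    rw [hT, mul_zero]
    rw [Fin.lt_def]
    by_contra hlt
    apply hx
    rw [Finset.mem_image]
    refine ⟨⟨x, ?_⟩, Finset.mem_univ _, ?_⟩
    · have := j.2; simp at hlt; omega
    · ext; simp
  rw [this, Matrix.det_mul]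
  congr 1
  rw [Matrix.det_of_isUpperTriangular]
  · rfl
  · intro i j hij
    exact hT _ _ hij


theorem PosL.det_ne_zero {n : ℕ} {A : Matrix (Fin n) (Fin n) ℝ} (hA : PosL A) : A.det ≠ 0 := by
  have := hA n le_rfl id strictMono_id
  have e : A.submatrix id (Fin.castLE le_rfl) = A := by ext i j; rfl
  rw [e] at this
  exact this.ne'

theorem qr0 {n : ℕ} (A : Matrix (Fin n) (Fin n) ℝ) :
    ∃ g T : Matrix (Fin n) (Fin n) ℝ, gᵀ * g = 1 ∧ A = g * T ∧ ∀ i j, j < i → T i j = 0 := by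
  let a : Fin n → EuclideanSpace ℝ (Fin n) := fun j => WithLp.toLp 2 (fun i => A i j)
  have hcard : Module.finrank ℝ (EuclideanSpace ℝ (Fin n)) = Fintype.card (Fin n) := by simp
  let b := InnerProductSpace.gramSchmidtOrthonormalBasis hcard a
  let g : Matrix (Fin n) (Fin n) ℝ := Matrix.of fun i j => b j i
  have hg : gᵀ * g = 1 := by
    ext i j
    have := orthonormal_iff_ite.mp b.orthonormal i j
    rw [Matrix.one_apply, ← this]
    simp [Matrix.mul_apply, g, PiLp.inner_apply, mul_comm]
  have hg' : g * gᵀ = 1 := mul_eq_one_comm.mp hg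
  refine ⟨g, gᵀ * A, hg, ?_, ?_⟩
  · rw [← mul_assoc, hg', one_mul]
  · intro i j hij
    have := InnerProductSpace.gramSchmidtOrthonormalBasis_inv_triangular hcard a hij
    rw [← this]
    simp [Matrix.mul_apply, g, PiLp.inner_apply, mul_comm, a, b]

theorem qr {n : ℕ} (A : Matrix (Fin n) (Fin n) ℝ) (hA : PosL A) :
    ∃ g T : Matrix (Fin n) (Fin n) ℝ, gᵀ * g = 1 ∧ PosL g ∧ A = g * T ∧ (∀ i j, j < i → T i j = 0)
      ∧ T.det ≠ 0 := by
  obtain ⟨g, T, hg, hAT, hT⟩ := qr0 A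
  have hdet : T.det ≠ 0 := by
    have := hA.det_ne_zero
    rw [hAT, Matrix.det_mul] at this
    exact right_ne_zero_of_mul this
  have hTd : ∀ i, T i i ≠ 0 := by
    rw [Matrix.det_of_isUpperTriangular (fun i j h => hT i j h)] at hdet
    intro i
    exact Finset.prod_ne_zero_iff.mp hdet i (Finset.mem_univ _)
  let e : Fin n → ℝ := fun i => if 0 < T i i then 1 else -1
  have he : ∀ i, e i * e i = 1 := by intro i; simp only [e]; split_ifs <;> norm_num
  have heT : ∀ i, 0 < e i * T i i := by
    intro i; simp only [e]
    split_ifs with h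
    · simpa using h
    · have := lt_of_le_of_ne (not_lt.mp h) (hTd i)
      linarith
  have hee : diagonal e * diagonal e = (1 : Matrix (Fin n) (Fin n) ℝ) := by
    rw [Matrix.diagonal_mul_diagonal, ← Matrix.diagonal_one]; congr 1; ext i; exact he i
  have hA2 : A = (g * diagonal e) * (diagonal e * T) := by
    rw [hAT, mul_assoc, ← mul_assoc (diagonal e), hee, one_mul]
  have hT2 : ∀ i j, j < i → (diagonal e * T) i j = 0 := by
    intro i j h; rw [Matrix.diagonal_mul, hT i j h, mul_zero]
  refine ⟨g * diagonal e, diagonal e * T, ?_, ?_, hA2, hT2, ?_⟩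
  · rw [Matrix.transpose_mul, Matrix.diagonal_transpose, mul_assoc, ← mul_assoc gᵀ, hg, one_mul, hee]
  · intro k hk f hf
    have := hA k hk f hf
    rw [hA2, minor_mul_upper hk _ _ hT2] at this
    refine pos_of_mul_pos_left this (Finset.prod_nonneg fun i _ => ?_)
    rw [Matrix.diagonal_mul]
    exact (heT _).le
  · rw [Matrix.det_mul, Matrix.det_diagonal]
    refine mul_ne_zero (Finset.prod_ne_zero_iff.mpr fun i _ h => ?_) hdet
    have := he i; rw [h] at this; norm_num at this

theorem unitary_real {n : ℕ} (g : Matrix (Fin n) (Fin n) ℂ) (hg : gᴴ * g = 1)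
    (hr : ∀ (k : ℕ) (h : k ≤ n) (f : Fin k → Fin n), StrictMono f →
      (g.submatrix f (Fin.castLE h)).det.im = 0) :
    ∀ (m : ℕ) (hm : m < n) (i : Fin n), (starRingEnd ℂ) (g i ⟨m, hm⟩) = g i ⟨m, hm⟩ := by
  intro m
  induction m using Nat.strong_induction_on with
  | _ m ih =>
  intro hm
  let x : Fin n → ℂ := fun i => g i ⟨m, hm⟩ - (starRingEnd ℂ) (g i ⟨m, hm⟩)
  have hk : m + 1 ≤ n := hm
  let G : Matrix (Fin n) (Fin (m+1)) ℂ := g.submatrix id (Fin.castLE hk)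
  let A : Matrix (Fin n) (Fin (m+1)) ℂ := Matrix.of fun i j => if j = Fin.last m then x i else G i j
  have hlt : ∀ j : Fin (m+1), j ≠ Fin.last m → (j : ℕ) < m := by
    intro j hj
    exact Fin.val_lt_last hj
  have hGreal : ∀ i j, j ≠ Fin.last m → (starRingEnd ℂ) (G i j) = G i j := by
    intro i j hj
    exact ih j (hlt j hj) (by have := hlt j hj; omega) i
  have horth : ∀ a b : Fin n, ∑ i, (starRingEnd ℂ) (g i a) * g i b = if a = b then 1 else 0 := by
    intro a b
    have := congrFun (congrFun hg a) b
    simpa [Matrix.mul_apply, Matrix.one_apply] using this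
  -- minors of `A` vanish
  have hminor : ∀ f : Fin (m+1) → Fin n, (A.submatrix f id).det = 0 := by
    intro f
    rcases sort_minor f with h | ⟨f', hf', s, hs⟩
    · exact minor_noninj _ _ h
    · rw [hs]
      have e1 : A.submatrix f' id = (G.submatrix f' id).updateCol (Fin.last m)
          ((fun i => G (f' i) (Fin.last m)) + (-1 : ℂ) • (fun i => (starRingEnd ℂ) (G (f' i) (Fin.last m)))) := by
        ext i j
        by_cases hj : j = Fin.last m
        · subst hj
          simp only [A, x, G, Matrix.submatrix_apply, Matrix.of_apply, id, if_true, Matrix.updateCol_self, Pi.add_apply, Pi.smul_apply, smul_eq_mul, neg_one_mul, sub_eq_add_neg]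
          rfl
        · simp [A, hj, Matrix.updateCol_ne]
      have e2 : (G.submatrix f' id).updateCol (Fin.last m) (fun i => G (f' i) (Fin.last m)) = G.submatrix f' id := by
        ext i j
        by_cases hj : j = Fin.last m
        · subst hj; simp
        · simp [hj, Matrix.updateCol_ne]
      have e3 : (G.submatrix f' id).updateCol (Fin.last m) (fun i => (starRingEnd ℂ) (G (f' i) (Fin.last m)))
          = (G.submatrix f' id).map (starRingEnd ℂ) := by
        ext i j
        by_cases hj : j = Fin.last m
        · subst hj; simp
        · simp [hj, Matrix.updateCol_ne, hGreal _ _ hj]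
      have e4 : ((G.submatrix f' id).map (starRingEnd ℂ)).det = (G.submatrix f' id).det := by
        have h1 : ((G.submatrix f' id).map (starRingEnd ℂ)).det = (starRingEnd ℂ) (G.submatrix f' id).det :=
          (RingHom.map_det (starRingEnd ℂ) _).symm
        rw [h1]
        exact Complex.conj_eq_iff_im.mpr (hr (m+1) hk f' hf')
      rw [e1, Matrix.det_updateCol_add, Matrix.det_updateCol_smul, e2, e3, e4]
      ring
  have hcb := cb_unsorted Aᴴ A
  have hz : (Aᴴ * A).det = 0 := by
    simp only [hminor, mul_zero, Finset.sum_const_zero] at hcb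
    exact (mul_eq_zero.mp hcb).resolve_left (by exact_mod_cast Nat.factorial_ne_zero _)
  have hx : ∀ j : Fin (m+1), j ≠ Fin.last m → ∑ i, (starRingEnd ℂ) (G i j) * x i = 0 := by
    intro j hj
    have hne : (Fin.castLE hk j) ≠ ⟨m, hm⟩ := by
      intro h; have := hlt j hj; have h2 := congrArg Fin.val h; simp at h2; omega
    have h1 := horth (Fin.castLE hk j) ⟨m, hm⟩
    rw [if_neg hne] at h1
    have h2 : ∑ i, (starRingEnd ℂ) (G i j) * (starRingEnd ℂ) (g i ⟨m, hm⟩) = 0 := by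
      have h3 := congrArg (starRingEnd ℂ) h1
      rw [map_sum, map_zero] at h3
      rw [← h3]
      refine Finset.sum_congr rfl fun i _ => ?_
      rw [map_mul]
      congr 1
      have := hGreal i j hj
      rw [this, Complex.conj_conj]; exact rfl
    simp only [x, mul_sub, Finset.sum_sub_distrib, h2, sub_zero]
    exact h1
  have hdiag : Aᴴ * A = diagonal (fun j => if j = Fin.last m then ∑ i, (starRingEnd ℂ) (x i) * x i else 1) := by
    ext a b
    simp only [Matrix.mul_apply, Matrix.conjTranspose_apply, Matrix.diagonal_apply, A, Matrix.of_apply]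
    by_cases ha : a = Fin.last m
    · by_cases hb : b = Fin.last m
      · simp [ha, hb]
      · have hab : a ≠ b := by rintro rfl; exact hb ha
        simp only [if_pos ha, if_neg hb, if_neg hab]
        have h3 := congrArg (starRingEnd ℂ) (hx b hb)
        rw [map_sum, map_zero] at h3
        rw [← h3]
        refine Finset.sum_congr rfl fun i _ => ?_
        rw [map_mul, Complex.conj_conj, mul_comm]
        rfl
    · by_cases hb : b = Fin.last m
      · have hab : a ≠ b := by rintro rfl; exact ha hb
        simp only [if_neg ha, if_pos hb, if_neg hab]
        exact hx a ha
      · simp only [if_neg ha, if_neg hb]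
        have := horth (Fin.castLE hk a) (Fin.castLE hk b)
        simp only [Fin.castLE_inj] at this
        exact this
  rw [hdiag, Matrix.det_diagonal] at hz
  have hz2 : ∑ i, (starRingEnd ℂ) (x i) * x i = 0 := by
    rw [Finset.prod_ite_eq_of_mem' _ _ _ (Finset.mem_univ _)] at hz
    exact hz
  intro i
  have hz3 : ∑ i, Complex.normSq (x i) = 0 := by
    have : ∑ i, (starRingEnd ℂ) (x i) * x i = ((∑ i, Complex.normSq (x i) : ℝ) : ℂ) := by
      push_cast
      refine Finset.sum_congr rfl fun i _ => ?_
      rw [mul_comm, Complex.mul_conj]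
    rw [this] at hz2
    exact_mod_cast hz2
  have := (Finset.sum_eq_zero_iff_of_nonneg (fun i _ => Complex.normSq_nonneg (x i))).mp hz3 i (Finset.mem_univ _)
  rw [Complex.normSq_eq_zero] at this
  exact (sub_eq_zero.mp this).symm

/-- Real orthogonal matrices with positive left minors. -/
def UR (n : ℕ) : Set (Matrix (Fin n) (Fin n) ℝ) := {g | gᵀ * g = 1 ∧ PosL g}

theorem UnitaryTP_eq (n : ℕ) : UnitaryTP n = (fun g : Matrix (Fin n) (Fin n) ℝ => g.map Complex.ofReal) '' UR n := by
  have hmin : ∀ (g : Matrix (Fin n) (Fin n) ℝ) (k : ℕ) (hk : k ≤ n) (f : Fin k → Fin n),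
      ((g.map Complex.ofReal).submatrix f (Fin.castLE hk)).det = ((g.submatrix f (Fin.castLE hk)).det : ℂ) := by
    intro g k hk f
    exact (RingHom.map_det Complex.ofRealHom (g.submatrix f (Fin.castLE hk))).symm
  have hct : ∀ (g : Matrix (Fin n) (Fin n) ℝ), (g.map Complex.ofReal)ᴴ * (g.map Complex.ofReal) = (gᵀ * g).map Complex.ofReal := by
    intro g
    ext i j
    simp [Matrix.mul_apply]
  ext g
  constructor
  · rintro ⟨hg, hpos⟩
    have hreal := unitary_real g hg (fun k hk f hf => by
      rw [strictMono_leftMinor g hk f hf]; exact (hpos _).2)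
    have hmap : (g.map Complex.re).map Complex.ofReal = g := by
      ext i j
      exact (Complex.conj_eq_iff_re.mp (hreal j j.2 i))
    refine ⟨g.map Complex.re, ⟨?_, ?_⟩, hmap⟩
    · have := hct (g.map Complex.re)
      rw [hmap, hg] at this
      ext i j
      have := congrFun (congrFun this i) j
      simp only [Matrix.map_apply, Matrix.one_apply] at this ⊢
      split_ifs at this ⊢ <;> exact_mod_cast this.symm
    · intro k hk f hf
      have h1 := hmin (g.map Complex.re) k hk f
      rw [hmap, strictMono_leftMinor g hk f hf] at h1
      have := (hpos (univ.image f)).1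
      rw [h1] at this
      exact this
  · rintro ⟨h, ⟨hh, hpos⟩, rfl⟩
    refine ⟨?_, ?_⟩
    · simp only
      rw [hct, hh]; ext i j; simp only [Matrix.map_apply, Matrix.one_apply]; split_ifs <;> simp
    · intro I
      have hI : I.card ≤ n := by simpa using Finset.card_le_univ I
      rw [leftMinor_eq _ I hI, hmin]
      refine ⟨?_, by simp⟩
      rw [Complex.ofReal_re]
      exact hpos _ hI _ (I.orderEmbOfFin rfl).strictMono


section expo
open scoped Matrix.Norms.Operator

theorem hasDerivAt_exp_entry {ι : Type} [Fintype ι] [DecidableEq ι] (B : Matrix ι ι ℝ) (t : ℝ) (i j : ι) :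
    HasDerivAt (fun s : ℝ => (NormedSpace.exp (s • B)) i j) ((NormedSpace.exp (t • B) * B) i j) t := by
  have h := hasDerivAt_exp_smul_const (𝕂 := ℝ) B t
  exact ((Matrix.entryLinearMap ℝ ℝ i j).toContinuousLinearMap.hasFDerivAt).comp_hasDerivAt t h

theorem ode_exp {ι : Type} [Fintype ι] [DecidableEq ι] (B : Matrix ι ι ℝ) (y : ℝ → ι → ℝ)
    (hy : ∀ t i, HasDerivAt (fun s => y s i) ((B *ᵥ y t) i) t) (t : ℝ) :
    y t = NormedSpace.exp (t • B) *ᵥ y 0 := by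
  have hW : ∀ i t, HasDerivAt (fun s => (NormedSpace.exp (s • (-B)) *ᵥ y s) i) 0 t := by
    intro i t
    have h1 : HasDerivAt (fun s => ∑ j, (NormedSpace.exp (s • (-B))) i j * y s j)
        (∑ j, ((NormedSpace.exp (t • (-B)) * (-B)) i j * y t j +
          (NormedSpace.exp (t • (-B))) i j * (B *ᵥ y t) j)) t :=
      HasDerivAt.fun_sum fun j _ => (hasDerivAt_exp_entry (-B) t i j).mul (hy t j)
    suffices key : ∑ j, ((NormedSpace.exp (t • (-B)) * (-B)) i j * y t j +
          (NormedSpace.exp (t • (-B))) i j * (B *ᵥ y t) j) = 0 by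
      rw [key] at h1; exact h1
    rw [Finset.sum_add_distrib]
    have e1 : ∑ j, (NormedSpace.exp (t • (-B)) * (-B)) i j * y t j = ((NormedSpace.exp (t • (-B)) * (-B)) *ᵥ y t) i := rfl
    have e2 : ∑ j, (NormedSpace.exp (t • (-B))) i j * (B *ᵥ y t) j = (NormedSpace.exp (t • (-B)) *ᵥ (B *ᵥ y t)) i := rfl
    rw [e1, e2, Matrix.mulVec_mulVec, Matrix.mul_neg, Matrix.neg_mulVec]
    simp
  have hc : NormedSpace.exp (t • (-B)) *ᵥ y t = y 0 := by
    ext i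
    have := is_const_of_deriv_eq_zero (f := fun s => (NormedSpace.exp (s • (-B)) *ᵥ y s) i)
      (fun t => (hW i t).differentiableAt) (fun t => (hW i t).deriv) t 0
    simp only [zero_smul, NormedSpace.exp_zero, Matrix.one_mulVec] at this
    exact this
  rw [← hc, Matrix.mulVec_mulVec]
  have : NormedSpace.exp (t • B) * NormedSpace.exp (t • (-B)) = 1 := by
    rw [← Matrix.exp_add_of_commute]
    · simp
    · simp [Commute.neg_right_iff]
  rw [this, Matrix.one_mulVec]

theorem exp_entry_pos {ι : Type} [Fintype ι] [DecidableEq ι] (B : Matrix ι ι ℝ) (hB : ∀ i j, 0 ≤ B i j)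
    (i j : ι) (hp : ∃ p : ℕ, 0 < (B ^ p) i j) (t : ℝ) (ht : 0 < t) :
    0 < (NormedSpace.exp (t • B)) i j := by
  have hs := NormedSpace.exp_series_hasSum_exp' (𝕂 := ℝ) (t • B)
  have h1 : HasSum (fun n : ℕ => ((n.factorial : ℝ)⁻¹ • (t • B) ^ n) i j) (NormedSpace.exp (t • B) i j) := by
    have hφ : ∀ X : Matrix ι ι ℝ, (Matrix.entryLinearMap ℝ ℝ i j).toContinuousLinearMap X = X i j :=
      fun X => rfl
    have h2 := (Matrix.entryLinearMap ℝ ℝ i j).toContinuousLinearMap.hasSum hs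
    simp only [hφ] at h2
    exact h2
  have hpow : ∀ (n : ℕ) i j, 0 ≤ (B ^ n) i j := by
    intro n
    induction n with
    | zero => intro i j; simp only [pow_zero, Matrix.one_apply]; split_ifs <;> norm_num
    | succ n ih => 
      intro i j
      rw [pow_succ, Matrix.mul_apply]
      exact Finset.sum_nonneg fun k _ => mul_nonneg (ih i k) (hB k j)
  have hnn : ∀ n : ℕ, 0 ≤ ((n.factorial : ℝ)⁻¹ • (t • B) ^ n) i j := by
    intro n
    rw [smul_pow]
    simp only [Matrix.smul_apply, smul_eq_mul]
    have := hpow n i j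
    positivity
  obtain ⟨p, hp⟩ := hp
  refine lt_of_lt_of_le ?_ (le_hasSum h1 p (fun n _ => hnn n))
  rw [smul_pow]
  simp only [Matrix.smul_apply, smul_eq_mul]
  positivity

end expo

theorem hasDerivAt_det {k : ℕ} (X : ℝ → Matrix (Fin k) (Fin k) ℝ) (X' : Matrix (Fin k) (Fin k) ℝ) (t : ℝ)
    (h : ∀ i j, HasDerivAt (fun s => X s i j) (X' i j) t) :
    HasDerivAt (fun s => (X s).det) (∑ i, ((X t).updateRow i (X' i)).det) t := by
  have h1 : HasDerivAt (fun s => ∑ σ : Equiv.Perm (Fin k), ((Equiv.Perm.sign σ : ℤ) : ℝ) * ∏ i, X s i (σ i))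
      (∑ σ : Equiv.Perm (Fin k), ((Equiv.Perm.sign σ : ℤ) : ℝ) * ∑ i, (∏ j ∈ Finset.univ.erase i, X t j (σ j)) • X' i (σ i)) t := by
    refine HasDerivAt.fun_sum fun σ _ => ?_
    exact (HasDerivAt.fun_finsetProd fun i _ => h i (σ i)).const_mul _
  have e : ∀ Y : Matrix (Fin k) (Fin k) ℝ, Y.det = ∑ σ : Equiv.Perm (Fin k), ((Equiv.Perm.sign σ : ℤ) : ℝ) * ∏ i, Y i (σ i) := by
    intro Y
    rw [← Matrix.det_transpose, Matrix.det_apply']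
    rfl
  simp only [e]
  convert h1 using 1
  rw [Finset.sum_comm]
  refine Finset.sum_congr rfl fun σ _ => ?_
  rw [← Finset.mul_sum]
  congr 1
  refine Finset.sum_congr rfl fun i _ => ?_
  rw [← Finset.mul_prod_erase _ _ (Finset.mem_univ i)]
  simp only [Matrix.updateRow_self, smul_eq_mul]
  rw [mul_comm]
  congr 1
  refine Finset.prod_congr rfl fun j hj => ?_
  rw [Matrix.updateRow_ne (Finset.ne_of_mem_erase hj)]

/-- adjacency matrix of the path. -/
def pathM (n : ℕ) : Matrix (Fin n) (Fin n) ℝ :=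
  Matrix.of fun i j => if (i : ℕ) + 1 = j ∨ (j : ℕ) + 1 = i then 1 else 0

theorem pathM_nonneg {n : ℕ} (i j : Fin n) : 0 ≤ pathM n i j := by
  simp only [pathM, Matrix.of_apply]; split_ifs <;> norm_num

theorem update_strict {n k : ℕ} (f : Fin k → Fin n) (hf : StrictMono f) (i : Fin k) (m : Fin n)
    (hm : (f i : ℕ) + 1 = m ∨ (m : ℕ) + 1 = f i) (hinj : Function.Injective (Function.update f i m)) :
    StrictMono (Function.update f i m) := by
  intro a b hab
  have hne : Function.update f i m a ≠ Function.update f i m b := fun h => hab.ne (hinj h)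
  have hfab := hf hab
  by_cases ha : a = i
  · subst ha
    have hb : b ≠ a := hab.ne'
    simp only [Function.update_self, Function.update_of_ne hb] at hne ⊢
    have : (m : ℕ) ≠ f b := fun h => hne (Fin.ext h)
    rw [Fin.lt_def] at hfab ⊢
    omega
  · by_cases hb : b = i
    · subst hb
      simp only [Function.update_self, Function.update_of_ne ha] at hne ⊢
      have : (f a : ℕ) ≠ m := fun h => hne (Fin.ext h)
      rw [Fin.lt_def] at hfab ⊢
      omega
    · simpa only [Function.update_of_ne ha, Function.update_of_ne hb] using hfab

/-- strictly monotone maps -/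
abbrev SM (k n : ℕ) := {f : Fin k → Fin n // StrictMono f}

open Classical in
/-- the induced operator on minors -/
noncomputable def bigB (k n : ℕ) : Matrix (SM k n) (SM k n) ℝ :=
  Matrix.of fun f g => ∑ i : Fin k, ∑ m : Fin n,
    if Function.update f.1 i m = g.1 then pathM n (f.1 i) m else 0

theorem bigB_nonneg {k n : ℕ} (f g : SM k n) : 0 ≤ bigB k n f g := by
  simp only [bigB, Matrix.of_apply]
  refine Finset.sum_nonneg fun i _ => Finset.sum_nonneg fun m _ => ?_
  split_ifs
  · exact pathM_nonneg _ _
  · exact le_rfl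

theorem bigB_pos {k n : ℕ} (f g : SM k n) (i : Fin k) (m : Fin n)
    (hm : (f.1 i : ℕ) + 1 = m ∨ (m : ℕ) + 1 = f.1 i) (hg : Function.update f.1 i m = g.1) :
    0 < bigB k n f g := by
  simp only [bigB, Matrix.of_apply]
  have hterm : ∀ i m, 0 ≤ (if Function.update f.1 i m = g.1 then pathM n (f.1 i) m else 0) := by
    intro i m; split_ifs
    · exact pathM_nonneg _ _
    · exact le_rfl
  refine Finset.sum_pos' (fun i _ => Finset.sum_nonneg fun m _ => hterm i m) ⟨i, Finset.mem_univ _, ?_⟩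
  refine Finset.sum_pos' (fun m _ => hterm i m) ⟨m, Finset.mem_univ _, ?_⟩
  rw [if_pos hg]
  simp [pathM, hm]

/-- reachability -/
def Reach {k n : ℕ} (f g : SM k n) : Prop := ∃ p : ℕ, 0 < (bigB k n ^ p) f g

theorem bigB_pow_nonneg {k n : ℕ} (p : ℕ) : ∀ (f g : SM k n), 0 ≤ (bigB k n ^ p) f g := by
  induction p with
  | zero => intro i j; simp only [pow_zero, Matrix.one_apply]; split_ifs <;> norm_num
  | succ p ih =>
    intro i j
    rw [pow_succ, Matrix.mul_apply]
    exact Finset.sum_nonneg fun k _ => mul_nonneg (ih i k) (bigB_nonneg k j)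

theorem Reach.refl {k n : ℕ} (f : SM k n) : Reach f f := ⟨0, by simp⟩

theorem Reach.trans {k n : ℕ} {f g h : SM k n} (h1 : Reach f g) (h2 : Reach g h) : Reach f h := by
  obtain ⟨p, hp⟩ := h1
  obtain ⟨q, hq⟩ := h2
  refine ⟨p + q, ?_⟩
  rw [pow_add, Matrix.mul_apply]
  exact Finset.sum_pos' (fun x _ => mul_nonneg (bigB_pow_nonneg p _ _) (bigB_pow_nonneg q _ _))
    ⟨g, Finset.mem_univ _, mul_pos hp hq⟩

theorem reach_base {k n : ℕ} (hk : k ≤ n) : ∀ (N : ℕ) (f : SM k n), (∑ i, (f.1 i : ℕ)) = N →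
    Reach f ⟨Fin.castLE hk, Fin.strictMono_castLE hk⟩ ∧ Reach ⟨Fin.castLE hk, Fin.strictMono_castLE hk⟩ f := by
  intro N
  induction N using Nat.strong_induction_on with
  | _ N ih =>
  intro f hN
  have hle : ∀ a : ℕ, ∀ h : a < k, a ≤ (f.1 ⟨a, h⟩ : ℕ) := by
    intro a
    induction a with
    | zero => intro h; omega
    | succ a iha =>
      intro h
      have h1 := iha (by omega)
      have h2 : f.1 ⟨a, by omega⟩ < f.1 ⟨a+1, h⟩ := f.2 (by simp [Fin.lt_def])
      rw [Fin.lt_def] at h2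
      omega
  by_cases hall : ∀ i : Fin k, (f.1 i : ℕ) = i
  · have : f = ⟨Fin.castLE hk, Fin.strictMono_castLE hk⟩ := by
      apply Subtype.ext
      funext i
      apply Fin.ext
      simpa using hall i
    rw [this]
    exact ⟨Reach.refl _, Reach.refl _⟩
  · have hex : ∃ a : ℕ, ∃ h : a < k, (f.1 ⟨a, h⟩ : ℕ) ≠ a := by
      push Not at hall
      obtain ⟨i, hi⟩ := hall
      exact ⟨i, i.2, hi⟩
    classical
    obtain ⟨ha, hne⟩ := Nat.find_spec hex
    set a := Nat.find hex with hadef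
    have hmin : ∀ b, b < a → ∀ h : b < k, (f.1 ⟨b, h⟩ : ℕ) = b := by
      intro b hb h
      by_contra hcon
      exact Nat.find_min hex hb ⟨h, hcon⟩
    have hgt : a < (f.1 ⟨a, ha⟩ : ℕ) := lt_of_le_of_ne (hle a ha) (Ne.symm hne)
    let m : Fin n := ⟨(f.1 ⟨a, ha⟩ : ℕ) - 1, by have := (f.1 ⟨a, ha⟩).2; omega⟩
    have hmv : (m : ℕ) + 1 = f.1 ⟨a, ha⟩ := by simp only [m]; omega
    have hsm : StrictMono (Function.update f.1 ⟨a, ha⟩ m) := by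
      apply update_strict f.1 f.2 _ _ (Or.inr hmv)
      have hno : ∀ c : Fin k, c ≠ ⟨a, ha⟩ → f.1 c ≠ m := by
        intro c hc heq
        have hv := congrArg Fin.val heq
        rcases lt_trichotomy (c : ℕ) a with h | h | h
        · have := hmin c h c.2
          simp only [Fin.eta] at this
          omega
        · exact hc (Fin.ext h)
        · have : f.1 ⟨a, ha⟩ < f.1 c := f.2 (by simpa [Fin.lt_def] using h)
          rw [Fin.lt_def] at this
          omega
      intro c d hcd
      by_cases hc : c = ⟨a, ha⟩
      · by_cases hd : d = ⟨a, ha⟩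
        · rw [hc, hd]
        · rw [hc, Function.update_self, Function.update_of_ne hd] at hcd
          exact absurd hcd.symm (hno d hd)
      · by_cases hd : d = ⟨a, ha⟩
        · rw [hd, Function.update_self, Function.update_of_ne hc] at hcd
          exact absurd hcd (hno c hc)
        · rw [Function.update_of_ne hc, Function.update_of_ne hd] at hcd
          exact f.2.injective hcd
    let g : SM k n := ⟨Function.update f.1 ⟨a, ha⟩ m, hsm⟩
    have hfg : 0 < bigB k n f g := bigB_pos f g ⟨a, ha⟩ m (Or.inr hmv) rfl
    have hgf : 0 < bigB k n g f := by
      refine bigB_pos g f ⟨a, ha⟩ (f.1 ⟨a, ha⟩) (Or.inl ?_) ?_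
      · simp only [g, Function.update_self]; exact hmv
      · simp [g]
    have hsum : ∑ i, (g.1 i : ℕ) < N := by
      rw [← hN]
      apply Finset.sum_lt_sum
      · intro i _
        by_cases hi : i = ⟨a, ha⟩
        · simp only [g, hi, Function.update_self]; omega
        · simp only [g, Function.update_of_ne hi]; exact le_rfl
      · exact ⟨⟨a, ha⟩, Finset.mem_univ _, by simp only [g, Function.update_self]; omega⟩
    obtain ⟨h1, h2⟩ := ih _ hsum g rfl
    exact ⟨Reach.trans ⟨1, by simpa using hfg⟩ h1, Reach.trans h2 ⟨1, by simpa using hgf⟩⟩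

theorem reach_all {k n : ℕ} (f g : SM k n) : Reach f g := by
  have hk : k ≤ n := by
    have := Fintype.card_le_of_injective f.1 f.2.injective
    simpa using this
  exact (reach_base hk _ f rfl).1.trans (reach_base hk _ g rfl).2

/-- Strict positivity of the flow. -/
theorem flow_pos {n k : ℕ} (E : ℝ → Matrix (Fin n) (Fin n) ℝ) (hE0 : E 0 = 1)
    (hE : ∀ t i j, HasDerivAt (fun s => E s i j) ((pathM n * E t) i j) t)
    (A : Matrix (Fin n) (Fin k) ℝ) (hA : ∀ f : Fin k → Fin n, StrictMono f → 0 ≤ (A.submatrix f id).det)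
    (hne : ∃ f : Fin k → Fin n, StrictMono f ∧ (A.submatrix f id).det ≠ 0) (t : ℝ) (ht : 0 < t)
    (f : Fin k → Fin n) (hf : StrictMono f) : 0 < ((E t * A).submatrix f id).det := by
  classical
  let y : ℝ → SM k n → ℝ := fun t f => ((E t * A).submatrix f.1 id).det
  have hEA : ∀ t i j, HasDerivAt (fun s => (E s * A) i j) ((pathM n * (E t * A)) i j) t := by
    intro t i j
    have h1 : HasDerivAt (fun s => ∑ m, E s i m * A m j) (∑ m, (pathM n * E t) i m * A m j) t :=
      HasDerivAt.fun_sum fun m _ => (hE t i m).mul_const _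
    have e : (pathM n * (E t * A)) i j = ∑ m, (pathM n * E t) i m * A m j := by
      rw [← Matrix.mul_assoc]; rfl
    rw [e]
    exact h1
  have hy : ∀ t f, HasDerivAt (fun s => y s f) ((bigB k n *ᵥ y t) f) t := by
    intro t f
    have h1 := hasDerivAt_det (fun s => (E s * A).submatrix f.1 id) ((pathM n * (E t * A)).submatrix f.1 id) t
      (fun i j => hEA t (f.1 i) j)
    convert h1 using 1
    have h2 : ∀ i : Fin k, ((((E t * A).submatrix f.1 id)).updateRow i (((pathM n * (E t * A)).submatrix f.1 id) i)).det
        = ∑ m, pathM n (f.1 i) m * ((E t * A).submatrix (Function.update f.1 i m) id).det := by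
      intro i
      have e1 : ((pathM n * (E t * A)).submatrix f.1 id) i = ∑ m, pathM n (f.1 i) m • (E t * A) m := by
        ext j
        simp [Matrix.mul_apply (M := pathM n), Finset.sum_apply]
      have e2 : ∀ w : Fin k → ℝ, (((E t * A).submatrix f.1 id).updateRow i w).det =
          Matrix.detRowAlternating.toMultilinearMap (Function.update (fun a => (E t * A) (f.1 a)) i w) := fun w => rfl
      rw [e1, e2, MultilinearMap.map_update_sum]
      refine Finset.sum_congr rfl fun m _ => ?_
      rw [MultilinearMap.map_update_smul, smul_eq_mul]
      congr 1
      change Matrix.det _ = Matrix.det _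
      congr 1
      ext a b
      by_cases ha : a = i
      · subst ha; simp
      · simp [Function.update_of_ne ha]
    simp only [h2]
    simp only [Matrix.mulVec, dotProduct, bigB, Matrix.of_apply, Finset.sum_mul]
    rw [Finset.sum_comm]
    refine Finset.sum_congr rfl fun i _ => ?_
    rw [Finset.sum_comm]
    refine Finset.sum_congr rfl fun m _ => ?_
    simp only [ite_mul, zero_mul]
    by_cases hs : StrictMono (Function.update f.1 i m)
    · rw [Finset.sum_eq_single (⟨Function.update f.1 i m, hs⟩ : SM k n)]
      · simp [y]
      · intro g _ hg
        rw [if_neg]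
        intro h
        exact hg (Subtype.ext h.symm)
      · intro h; exact absurd (Finset.mem_univ _) h
    · rw [Finset.sum_eq_zero]
      · by_cases hadj : (f.1 i : ℕ) + 1 = m ∨ (m : ℕ) + 1 = f.1 i
        · rw [minor_noninj _ _ (fun hinj => hs (update_strict f.1 f.2 i m hadj hinj)), mul_zero]
        · simp [pathM, hadj]
      · intro g _
        rw [if_neg]
        intro h
        exact hs (h ▸ g.2)
  have hsol := ode_exp (bigB k n) y hy t
  have hy0 : ∀ f : SM k n, y 0 f = (A.submatrix f.1 id).det := by
    intro f; simp [y, hE0]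
  have := congrFun hsol ⟨f, hf⟩
  change y t ⟨f, hf⟩ > 0
  rw [this]
  obtain ⟨f0, hf0, hne⟩ := hne
  have hexp : ∀ f g, 0 < NormedSpace.exp (t • bigB k n) f g := fun f g =>
    exp_entry_pos (bigB k n) bigB_nonneg f g (reach_all f g) t ht
  refine Finset.sum_pos' (fun g _ => mul_nonneg (hexp _ _).le ?_) ⟨⟨f0, hf0⟩, Finset.mem_univ _, mul_pos (hexp _ _) ?_⟩
  · rw [hy0]; exact hA _ g.2
  · rw [hy0]; exact lt_of_le_of_ne (hA _ hf0) hne.symm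


theorem path_eig_zero {n : ℕ} (w : Fin n → ℝ) (μ : ℝ) (hw : pathM n *ᵥ w = μ • w)
    (h0 : ∀ h : 0 < n, w ⟨0, h⟩ = 0) : w = 0 := by
  have : ∀ m : ℕ, ∀ h : m < n, w ⟨m, h⟩ = 0 := by
    intro m
    induction m using Nat.strong_induction_on with
    | _ m ih =>
    intro h
    rcases m with _ | m
    · exact h0 h
    · have h1 := congrFun hw ⟨m, by omega⟩
      simp only [Pi.smul_apply, ih m (by omega) (by omega), smul_zero, Matrix.mulVec, dotProduct] at h1
      rw [Finset.sum_eq_single (⟨m+1, h⟩ : Fin n)] at h1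
      · simpa [pathM] using h1
      · intro b _ hb
        have hbv : (b : ℕ) ≠ m + 1 := fun hh => hb (Fin.ext hh)
        by_cases hlt : (b : ℕ) < m + 1
        · have := ih b hlt b.2
          simp only [Fin.eta] at this
          rw [this, mul_zero]
        · have : ¬ ((m : ℕ) + 1 = b ∨ (b : ℕ) + 1 = m) := by omega
          simp [pathM, this]
      · intro hh; exact absurd (Finset.mem_univ _) hh
  ext i
  exact this i i.2

theorem pathM_symm (n : ℕ) : (pathM n)ᵀ = pathM n := by
  ext i j
  simp only [pathM, Matrix.transpose_apply, Matrix.of_apply, or_comm]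

theorem spectral_path (n : ℕ) : ∃ (S : Matrix (Fin n) (Fin n) ℝ) (μ : Fin n → ℝ),
    Sᵀ * S = 1 ∧ StrictAnti μ ∧ pathM n * S = S * diagonal μ := by
  have hM : (pathM n).IsHermitian := by
    rw [Matrix.IsHermitian, Matrix.conjTranspose_eq_transpose_of_trivial, pathM_symm]
  let b := hM.eigenvectorBasis
  let ν := hM.eigenvalues
  have hb : ∀ j, pathM n *ᵥ (b j : Fin n → ℝ) = ν j • (b j : Fin n → ℝ) := fun j => hM.mulVec_eigenvectorBasis j
  have horth : ∀ i j, ∑ x, b i x * b j x = if i = j then 1 else 0 := by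
    intro i j
    rw [← orthonormal_iff_ite.mp b.orthonormal i j]
    simp [PiLp.inner_apply, mul_comm]
  have hinj : Function.Injective ν := by
    intro i j hij
    by_contra hne
    have hn : 0 < n := lt_of_le_of_lt (Nat.zero_le _) i.2
    have hw : (b j ⟨0, hn⟩) • (b i : Fin n → ℝ) - (b i ⟨0, hn⟩) • (b j : Fin n → ℝ) = 0 := by
      apply path_eig_zero _ (ν i)
      · rw [Matrix.mulVec_sub, Matrix.mulVec_smul, Matrix.mulVec_smul, hb, hb, hij]
        rw [smul_sub, smul_comm, smul_comm (b i ⟨0, hn⟩)]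
      · intro h; simp [mul_comm]
    have h1 : b j ⟨0, hn⟩ = 0 := by
      have h2 : ∑ x, b i x * (((b j ⟨0, hn⟩) • (b i : Fin n → ℝ) - (b i ⟨0, hn⟩) • (b j : Fin n → ℝ)) x) = 0 := by
        rw [hw]; simp
      have h3 : ∑ x, b i x * (((b j ⟨0, hn⟩) • (b i : Fin n → ℝ) - (b i ⟨0, hn⟩) • (b j : Fin n → ℝ)) x) =
         b j ⟨0, hn⟩ * (∑ x, b i x * b i x) - b i ⟨0, hn⟩ * ∑ x, b i x * b j x := by
        rw [Finset.mul_sum, Finset.mul_sum, ← Finset.sum_sub_distrib]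
        refine Finset.sum_congr rfl fun x _ => ?_
        simp only [Pi.sub_apply, Pi.smul_apply, smul_eq_mul]; ring
      rw [h3, horth, horth, if_pos rfl, if_neg hne] at h2
      linarith
    have h4 : (b j : Fin n → ℝ) = 0 := path_eig_zero _ (ν j) (hb j) (fun _ => h1)
    have h5 := horth j j
    rw [if_pos rfl, h4] at h5
    simp at h5
  let σ := Tuple.sort (fun i => - ν i)
  refine ⟨Matrix.of fun i j => b (σ j) i, fun j => ν (σ j), ?_, ?_, ?_⟩
  · ext i j
    simp only [Matrix.mul_apply, Matrix.transpose_apply, Matrix.of_apply, horth, Matrix.one_apply,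
      σ.injective.eq_iff]
  · have h1 : StrictMono ((fun i => - ν i) ∘ σ) :=
      (Tuple.monotone_sort _).strictMono_of_injective ((neg_injective.comp hinj).comp σ.injective)
    intro i j hij
    have := h1 hij
    simp only [Function.comp] at this
    linarith
  · ext i j
    rw [Matrix.mul_diagonal]
    have := congrFun (hb (σ j)) i
    simp only [Matrix.of_apply]
    rw [mul_comm]
    exact this

/-- The flow matrices. -/
noncomputable def flowE {n : ℕ} (S : Matrix (Fin n) (Fin n) ℝ) (μ : Fin n → ℝ) (t : ℝ) :
    Matrix (Fin n) (Fin n) ℝ := S * diagonal (fun i => Real.exp (t * μ i)) * Sᵀ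

theorem flowE_zero {n : ℕ} (S : Matrix (Fin n) (Fin n) ℝ) (μ : Fin n → ℝ) (hS : Sᵀ * S = 1) : flowE S μ 0 = 1 := by
  simp [flowE, mul_eq_one_comm.mp hS]

theorem flowE_deriv {n : ℕ} (S : Matrix (Fin n) (Fin n) ℝ) (μ : Fin n → ℝ)
    (hM : pathM n * S = S * diagonal μ) (t : ℝ) (i j : Fin n) :
    HasDerivAt (fun s => flowE S μ s i j) ((pathM n * flowE S μ t) i j) t := by
  have h1 : HasDerivAt (fun s => ∑ m, S i m * Real.exp (s * μ m) * S j m)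
      (∑ m, S i m * (Real.exp (t * μ m) * (1 * μ m)) * S j m) t := by
    refine HasDerivAt.fun_sum fun m _ => ?_
    refine HasDerivAt.mul_const (HasDerivAt.const_mul _ ?_) _
    exact ((hasDerivAt_id t).mul_const (μ m)).exp
  have e1 : (fun s => flowE S μ s i j) = (fun s => ∑ m, S i m * Real.exp (s * μ m) * S j m) := by
    funext s
    unfold flowE
    rw [Matrix.mul_apply]
    simp [Matrix.mul_diagonal]
  have e2 : (pathM n * flowE S μ t) i j = ∑ m, S i m * (Real.exp (t * μ m) * (1 * μ m)) * S j m := by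
    unfold flowE
    rw [← Matrix.mul_assoc, ← Matrix.mul_assoc, hM, Matrix.mul_assoc S, Matrix.diagonal_mul_diagonal, Matrix.mul_apply]
    refine Finset.sum_congr rfl fun m _ => ?_
    simp only [Matrix.mul_diagonal, Matrix.transpose_apply]
    ring
  rw [e1, e2]
  exact h1

theorem indicator_minor {n k : ℕ} (f f' : Fin k → Fin n) (hf : StrictMono f) (hf' : StrictMono f') (hne : f' ≠ f) :
    ((Matrix.of fun (i : Fin n) (j : Fin k) => if i = f j then (1:ℝ) else 0).submatrix f' id).det = 0 := by
  have : ∃ i, ∀ j, f' i ≠ f j := by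
    by_contra hcon
    push Not at hcon
    apply hne
    have hsub : Finset.univ.image f' ⊆ Finset.univ.image f := by
      intro x hx
      simp only [Finset.mem_image, Finset.mem_univ, true_and] at hx ⊢
      obtain ⟨i, rfl⟩ := hx
      obtain ⟨j, hj⟩ := hcon i
      exact ⟨j, hj.symm⟩
    have heq := Finset.eq_of_subset_of_card_le hsub (by
      rw [Finset.card_image_of_injective _ hf.injective, Finset.card_image_of_injective _ hf'.injective])
    have hr : Set.range f' = Set.range f := by
      have := congrArg (fun s : Finset (Fin n) => (s : Set (Fin n))) heq
      simpa using this
    exact (StrictMono.range_inj hf' hf).mp hr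
  obtain ⟨i, hi⟩ := this
  exact Matrix.det_eq_zero_of_row_eq_zero i (fun j => by simp [hi j])

theorem minor_sign {n k : ℕ} (hk : k ≤ n) (S : Matrix (Fin n) (Fin n) ℝ) (μ : Fin n → ℝ) (hS : Sᵀ * S = 1)
    (hμ : StrictAnti μ) (hM : pathM n * S = S * diagonal μ) (f f' : Fin k → Fin n) (hf : StrictMono f)
    (hf' : StrictMono f') :
    0 ≤ (S.submatrix f (Fin.castLE hk)).det * (S.submatrix f' (Fin.castLE hk)).det := by
  by_cases hz : (S.submatrix f (Fin.castLE hk)).det = 0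
  · rw [hz, zero_mul]
  let A : Matrix (Fin n) (Fin k) ℝ := Matrix.of fun (i : Fin n) (j : Fin k) => if i = f j then (1:ℝ) else 0
  have hAf : (A.submatrix f id).det = 1 := by
    have : A.submatrix f id = 1 := by
      ext i j
      simp [A, Matrix.one_apply, hf.injective.eq_iff]
    rw [this, Matrix.det_one]
  have hpos : ∀ t : ℝ, 0 < t → 0 < ((flowE S μ t * A).submatrix f' id).det := by
    intro t ht
    refine flow_pos (flowE S μ) (flowE_zero S μ hS) (flowE_deriv S μ hM) A ?_ ⟨f, hf, by rw [hAf]; norm_num⟩ t ht f' hf'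
    intro h hh
    by_cases hhf : h = f
    · rw [hhf, hAf]; norm_num
    · exact (indicator_minor f h hf hh hhf).ge
  let W : Matrix (Fin n) (Fin k) ℝ := Sᵀ * A
  let W0 : Matrix (Fin k) (Fin k) ℝ := W.submatrix (Fin.castLE hk) id
  have hW0 : W0 = (S.submatrix f (Fin.castLE hk))ᵀ := by
    ext i j
    simp [W0, W, A, Matrix.mul_apply]
  have hdW0 : W0.det = (S.submatrix f (Fin.castLE hk)).det := by rw [hW0, Matrix.det_transpose]
  have hW0u : IsUnit W0.det := by rw [hdW0]; exact isUnit_iff_ne_zero.mpr hz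
  let V : Matrix (Fin n) (Fin k) ℝ := W * W0⁻¹
  have hV : ∀ a b, V (Fin.castLE hk a) b = if a = b then 1 else 0 := by
    intro a b
    have h1 : V.submatrix (Fin.castLE hk) id = W0 * W0⁻¹ := by
      ext i j; simp [V, W0, Matrix.mul_apply]
    rw [Matrix.mul_nonsing_inv _ hW0u] at h1
    have := congrFun (congrFun h1 a) b
    simpa [Matrix.one_apply] using this
  let D : ℝ → Matrix (Fin k) (Fin k) ℝ := fun t => diagonal fun j => Real.exp (-(t * μ (Fin.castLE hk j)))
  let Z : ℝ → Matrix (Fin n) (Fin k) ℝ := fun t => flowE S μ t * A * W0⁻¹ * D t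
  have hZdet : ∀ t, ((Z t).submatrix f' id).det = ((flowE S μ t * A).submatrix f' id).det * (W0.det)⁻¹ * (D t).det := by
    intro t
    have : (Z t).submatrix f' id = (flowE S μ t * A).submatrix f' id * W0⁻¹ * D t := by
      simp only [Z]
      ext i j
      simp [Matrix.mul_apply]
    rw [this, Matrix.det_mul, Matrix.det_mul, Matrix.det_nonsing_inv, Ring.inverse_eq_inv']
  have hZ : ∀ t i j, Z t i j = ∑ m, S i m * (Real.exp (t * (μ m - μ (Fin.castLE hk j))) * V m j) := by
    intro t i j
    have : Z t = S * (diagonal (fun i => Real.exp (t * μ i)) * V * D t) := by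
      simp only [Z, V, W, flowE, Matrix.mul_assoc]
    rw [this, Matrix.mul_apply]
    refine Finset.sum_congr rfl fun m _ => ?_
    simp only [D, Matrix.mul_diagonal, Matrix.diagonal_mul]
    rw [mul_sub, sub_eq_add_neg, Real.exp_add]
    ring
  have hlim : ∀ i j, Filter.Tendsto (fun t => Z t i j) Filter.atTop (nhds (S i (Fin.castLE hk j))) := by
    intro i j
    simp only [hZ]
    have e : S i (Fin.castLE hk j) = ∑ m, S i m * (if m = Fin.castLE hk j then 1 else 0) := by simp
    rw [e]
    refine tendsto_finsetSum _ fun m _ => Filter.Tendsto.const_mul _ ?_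
    by_cases hmk : (m : ℕ) < k
    · have hm : m = Fin.castLE hk ⟨m, hmk⟩ := by ext; simp
      have hVm : V m j = if m = Fin.castLE hk j then 1 else 0 := by
        conv_lhs => rw [hm, hV]
        congr 1
        simp [Fin.ext_iff]
      rw [hVm]
      split_ifs with hmj
      · rw [hmj]; simp
      · simp
    · have hlt : μ m - μ (Fin.castLE hk j) < 0 := by
        have : Fin.castLE hk j < m := by rw [Fin.lt_def]; have := j.2; simp; omega
        have := hμ this
        linarith
      have hne : m ≠ Fin.castLE hk j := by
        intro h; rw [h] at hlt; simp at hlt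
      rw [if_neg hne]
      have h1 : Filter.Tendsto (fun t : ℝ => Real.exp (t * (μ m - μ (Fin.castLE hk j)))) Filter.atTop (nhds 0) :=
        Real.tendsto_exp_atBot.comp (Filter.Tendsto.atTop_mul_const_of_neg hlt Filter.tendsto_id)
      simpa using h1.mul_const (V m j)
  have hlimdet : Filter.Tendsto (fun t => ((Z t).submatrix f' id).det) Filter.atTop
      (nhds (S.submatrix f' (Fin.castLE hk)).det) := by
    have hc : Continuous (fun X : Matrix (Fin k) (Fin k) ℝ => X.det) := continuous_id.matrix_det
    refine (hc.tendsto _).comp ?_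
    refine tendsto_pi_nhds.mpr fun i => tendsto_pi_nhds.mpr fun j => ?_
    exact hlim (f' i) j
  have hfin : Filter.Tendsto (fun t => (S.submatrix f (Fin.castLE hk)).det * ((Z t).submatrix f' id).det) Filter.atTop
      (nhds ((S.submatrix f (Fin.castLE hk)).det * (S.submatrix f' (Fin.castLE hk)).det)) := hlimdet.const_mul _
  refine ge_of_tendsto hfin ?_
  filter_upwards [Filter.eventually_gt_atTop 0] with t ht
  rw [hZdet, hdW0]
  have h1 := hpos t ht
  have h2 : 0 < (D t).det := by
    simp only [D, Matrix.det_diagonal]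
    exact Finset.prod_pos fun i _ => Real.exp_pos _
  have : (S.submatrix f (Fin.castLE hk)).det * (((flowE S μ t * A).submatrix f' id).det * ((S.submatrix f (Fin.castLE hk)).det)⁻¹ * (D t).det) = ((flowE S μ t * A).submatrix f' id).det * (D t).det := by
    field_simp
  rw [this]
  positivity

theorem spectral_pos (n : ℕ) : ∃ (S : Matrix (Fin n) (Fin n) ℝ) (μ : Fin n → ℝ),
    Sᵀ * S = 1 ∧ StrictAnti μ ∧ pathM n * S = S * diagonal μ ∧ PosL S := by
  obtain ⟨S, μ, hS, hμ, hM⟩ := spectral_path n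
  have hdet : S.det ≠ 0 := by
    intro h
    have := congrArg Matrix.det hS
    rw [Matrix.det_mul, h, mul_zero, Matrix.det_one] at this
    norm_num at this
  have hσ : ∀ k : ℕ, ∃ s : ℝ, s * s = 1 ∧ ∀ (hk : k ≤ n) (f : Fin k → Fin n), StrictMono f →
      0 ≤ s * (S.submatrix f (Fin.castLE hk)).det := by
    intro k
    by_cases hk : k ≤ n
    · obtain ⟨f0, hf0, hne⟩ := exists_minor_ne_zero S hdet hk
      rcases lt_or_gt_of_ne hne with h | h
      · refine ⟨-1, by norm_num, fun _ f hf => ?_⟩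
        have := minor_sign hk S μ hS hμ hM f0 f hf0 hf
        have := nonpos_of_mul_nonneg_right this h
        linarith
      · refine ⟨1, by norm_num, fun _ f hf => ?_⟩
        have := minor_sign hk S μ hS hμ hM f0 f hf0 hf
        have := nonneg_of_mul_nonneg_right this h
        linarith
    · exact ⟨1, by norm_num, fun h => absurd h hk⟩
  choose s hs1 hs2 using hσ
  have hs0 : s 0 = 1 := by
    have h := hs2 0 (Nat.zero_le _) (fun i => i.elim0) (fun i => i.elim0)
    simp at h
    nlinarith [hs1 0]
  let e : Fin n → ℝ := fun i => s i * s (i+1)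
  have he : ∀ i, e i * e i = 1 := by
    intro i
    have h1 := hs1 i
    have h2 := hs1 (i+1)
    calc e i * e i = (s i * s i) * (s (i+1) * s (i+1)) := by simp only [e]; ring
      _ = 1 := by rw [h1, h2]; norm_num
  have hprod : ∀ (k : ℕ) (hk : k ≤ n), ∏ i : Fin k, e (Fin.castLE hk i) = s k := by
    intro k
    induction k with
    | zero => intro hk; simp [hs0]
    | succ k ih =>
      intro hk
      rw [Fin.prod_univ_castSucc]
      have := ih (by omega)
      have h2 : ∏ i : Fin k, e (Fin.castLE hk (Fin.castSucc i)) = s k := this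
      rw [h2]
      simp only [e, Fin.val_castLE, Fin.val_last]
      rw [← mul_assoc, hs1, one_mul]
  have hee : diagonal e * diagonal e = (1 : Matrix (Fin n) (Fin n) ℝ) := by
    rw [Matrix.diagonal_mul_diagonal, ← Matrix.diagonal_one]; congr 1; ext i; exact he i
  have hS' : (S * diagonal e)ᵀ * (S * diagonal e) = 1 := by
    rw [Matrix.transpose_mul, Matrix.diagonal_transpose, mul_assoc, ← mul_assoc Sᵀ, hS, one_mul, hee]
  have hM' : pathM n * (S * diagonal e) = (S * diagonal e) * diagonal μ := by
    rw [← mul_assoc, hM, mul_assoc, mul_assoc, Matrix.diagonal_mul_diagonal, Matrix.diagonal_mul_diagonal]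
    congr 2; ext i; ring
  have hnn : NonnegL (S * diagonal e) := by
    intro k hk f hf
    rw [minor_mul_upper hk _ _ (fun i j h => Matrix.diagonal_apply_ne _ h.ne')]
    simp only [Matrix.diagonal_apply_eq]
    rw [hprod, mul_comm]
    exact hs2 k hk f hf
  have hdet' : (S * diagonal e).det ≠ 0 := by
    rw [Matrix.det_mul, Matrix.det_diagonal]
    refine mul_ne_zero hdet (Finset.prod_ne_zero_iff.mpr fun i _ h => ?_)
    have := he i; rw [h] at this; norm_num at this
  refine ⟨S * diagonal e, μ, hS', hμ, hM', ?_⟩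
  intro k hk f hf
  have h1 := flow_pos (flowE (S * diagonal e) μ) (flowE_zero _ μ hS') (flowE_deriv _ μ hM')
    ((S * diagonal e).submatrix id (Fin.castLE hk)) (fun f hf => hnn k hk f hf)
    (exists_minor_ne_zero _ hdet' hk) 1 one_pos f hf
  have h2 : (flowE (S * diagonal e) μ 1 * ((S * diagonal e).submatrix id (Fin.castLE hk))).submatrix f id
      = ((S * diagonal e) * diagonal (fun i => Real.exp (1 * μ i))).submatrix f (Fin.castLE hk) := by
    have h3 : flowE (S * diagonal e) μ 1 * (S * diagonal e) = (S * diagonal e) * diagonal (fun i => Real.exp (1 * μ i)) := by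
      unfold flowE
      rw [mul_assoc, hS', mul_one]
    rw [← h3]
    ext i j
    simp [Matrix.mul_apply (M := flowE (S * diagonal e) μ 1)]
  rw [h2, minor_mul_upper hk _ _ (fun i j h => Matrix.diagonal_apply_ne _ h.ne')] at h1
  simp only [Matrix.diagonal_apply_eq] at h1
  exact pos_of_mul_pos_left h1 (Finset.prod_nonneg fun i _ => (Real.exp_pos _).le)


/-- Block upper triangular with respect to `lam`. -/
def BU {n : ℕ} (lam : Fin n → ℝ) (q : Matrix (Fin n) (Fin n) ℝ) : Prop :=
  ∀ i j, lam i < lam j → q i j = 0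

/-- Unipotent lower block triangular with respect to `lam`. -/
def Uni {n : ℕ} (lam : Fin n → ℝ) (N : Matrix (Fin n) (Fin n) ℝ) : Prop :=
  ∀ i j, ¬ lam i < lam j → N i j = (1 : Matrix (Fin n) (Fin n) ℝ) i j

noncomputable def Ymat {n : ℕ} (lam : Fin n → ℝ) (X : Matrix (Fin n) (Fin n) ℝ) (j : Fin n) :
    Matrix (Fin n) (Fin n) ℝ :=
  Matrix.of fun i k => if lam i < lam j then (1 : Matrix (Fin n) (Fin n) ℝ) i k else X i k

noncomputable def chartN {n : ℕ} (lam : Fin n → ℝ) (X : Matrix (Fin n) (Fin n) ℝ) :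
    Matrix (Fin n) (Fin n) ℝ :=
  Matrix.of fun i j => (X * (Ymat lam X j)⁻¹) i j

theorem BU.mul {n : ℕ} {lam : Fin n → ℝ} {a b : Matrix (Fin n) (Fin n) ℝ} (ha : BU lam a)
    (hb : BU lam b) : BU lam (a * b) := by
  intro i j hij
  rw [Matrix.mul_apply]
  refine Finset.sum_eq_zero fun k _ => ?_
  by_cases h : lam i < lam k
  · rw [ha i k h, zero_mul]
  · rw [hb k j (lt_of_le_of_lt (not_lt.mp h) hij), mul_zero]

theorem BU.inv {n : ℕ} {lam : Fin n → ℝ} {a : Matrix (Fin n) (Fin n) ℝ} (ha : BU lam a)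
    (hdet : a.det ≠ 0) : BU lam a⁻¹ := by
  have h1 : Matrix.BlockTriangular a (OrderDual.toDual ∘ lam) := fun i j h => ha i j h
  have : Invertible a := Matrix.invertibleOfIsUnitDet a (isUnit_iff_ne_zero.mpr hdet)
  have h2 := Matrix.blockTriangular_inv_of_blockTriangular h1
  exact fun i j h => h2 h

theorem BU_of_upper {n : ℕ} {lam : Fin n → ℝ} (hl : Antitone lam) {T : Matrix (Fin n) (Fin n) ℝ}
    (hT : ∀ i j, j < i → T i j = 0) : BU lam T := by
  intro i j hij
  refine hT i j ?_
  by_contra h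
  exact absurd (hl (not_lt.mp h)) (not_le.mpr hij)

theorem Uni.det {n : ℕ} {lam : Fin n → ℝ} (hl : Antitone lam) {N : Matrix (Fin n) (Fin n) ℝ}
    (hN : Uni lam N) : N.det = 1 := by
  rw [Matrix.det_of_isLowerTriangular N]
  · exact Finset.prod_eq_one fun i _ => by rw [hN i i (lt_irrefl _), Matrix.one_apply_eq]
  · intro i j hij
    have hij' : i < j := hij
    rw [hN i j (not_lt.mpr (hl hij'.le)), Matrix.one_apply_ne hij'.ne]

theorem chart_unique {n : ℕ} (lam : Fin n → ℝ) (X N q : Matrix (Fin n) (Fin n) ℝ)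
    (hY : ∀ j, (Ymat lam X j).det ≠ 0) (hN : Uni lam N) (hq : BU lam q) (h : N = X * q) :
    N = chartN lam X := by
  ext i j
  have h1 : Ymat lam X j *ᵥ q.col j = (1 : Matrix (Fin n) (Fin n) ℝ).col j := by
    ext r
    simp only [Matrix.mulVec, dotProduct, Ymat, Matrix.of_apply, Matrix.col_apply]
    by_cases hr : lam r < lam j
    · simp only [hr, if_true]
      have := hq r j hr
      have hne : r ≠ j := by rintro rfl; exact lt_irrefl _ hr
      rw [Matrix.one_apply_ne hne, ← this]
      simp [Matrix.one_apply]
    · simp only [hr, if_false]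
      rw [← hN r j hr, h, Matrix.mul_apply]
  have h2 : q.col j = (Ymat lam X j)⁻¹ *ᵥ (1 : Matrix (Fin n) (Fin n) ℝ).col j := by
    rw [← h1, Matrix.mulVec_mulVec, Matrix.nonsing_inv_mul _ (isUnit_iff_ne_zero.mpr (hY j)),
      Matrix.one_mulVec]
  rw [h, Matrix.mul_apply, chartN, Matrix.of_apply, Matrix.mul_apply]
  refine Finset.sum_congr rfl fun k _ => ?_
  congr 1
  have := congrFun h2 k
  simpa [Matrix.mulVec, dotProduct, Matrix.one_apply] using this

theorem chart_exists {n : ℕ} (lam : Fin n → ℝ) (X : Matrix (Fin n) (Fin n) ℝ)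
    (hY : ∀ j, (Ymat lam X j).det ≠ 0) :
    ∃ q, BU lam q ∧ Uni lam (chartN lam X) ∧ chartN lam X = X * q := by
  let q : Matrix (Fin n) (Fin n) ℝ := Matrix.of fun k j => (Ymat lam X j)⁻¹ k j
  have h0 : chartN lam X = X * q := by
    ext i j; simp [chartN, q, Matrix.mul_apply]
  have h1 : ∀ i j, ∑ k, Ymat lam X j i k * q k j = (1 : Matrix (Fin n) (Fin n) ℝ) i j := by
    intro i j
    rw [← Matrix.mul_nonsing_inv (Ymat lam X j) (isUnit_iff_ne_zero.mpr (hY j)), Matrix.mul_apply]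
    rfl
  refine ⟨q, ?_, ?_, h0⟩
  · intro i j hij
    have := h1 i j
    have hne : i ≠ j := by rintro rfl; exact lt_irrefl _ hij
    rw [Matrix.one_apply_ne hne] at this
    simpa [Ymat, hij, Matrix.one_apply] using this
  · intro i j hij
    rw [h0, ← h1 i j, Matrix.mul_apply]
    simp [Ymat, hij]

theorem lower_seg {n : ℕ} (p : Fin n → Prop) (hp : ∀ i j, i ≤ j → p j → p i) :
    ∃ k, k ≤ n ∧ ∀ i : Fin n, p i ↔ (i : ℕ) < k := by
  classical
  by_cases h : ∃ m, ∃ hm : m < n, ¬ p ⟨m, hm⟩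
  · refine ⟨Nat.find h, ?_, fun i => ?_⟩
    · obtain ⟨hm, _⟩ := Nat.find_spec h; exact hm.le
    · obtain ⟨hm, hm2⟩ := Nat.find_spec h
      constructor
      · intro hi
        by_contra hc
        exact hm2 (hp ⟨_, hm⟩ i (by rw [Fin.le_def]; simpa using hc) hi)
      · intro hi
        by_contra hc
        exact Nat.find_min h hi ⟨i.2, hc⟩
  · push Not at h
    exact ⟨n, le_rfl, fun i => ⟨fun _ => i.2, fun _ => h i i.2⟩⟩

theorem Y_det_ne {n : ℕ} (lam : Fin n → ℝ) (hl : Antitone lam) (X : Matrix (Fin n) (Fin n) ℝ)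
    (hX : ∀ (k : ℕ) (hk : k ≤ n), (X.submatrix (Fin.castLE hk) (Fin.castLE hk)).det ≠ 0) (j : Fin n) :
    (Ymat lam X j).det ≠ 0 := by
  intro hdet
  obtain ⟨v, hv, hYv⟩ := Matrix.exists_mulVec_eq_zero_iff.mpr hdet
  obtain ⟨k, hk, hp⟩ := lower_seg (fun i => ¬ lam i < lam j)
    (fun a b hab hb => not_lt.mpr (le_trans (not_lt.mp hb) (hl hab)))
  have hv0 : ∀ i, lam i < lam j → v i = 0 := by
    intro i hi
    have := congrFun hYv i
    simpa [Matrix.mulVec, dotProduct, Ymat, hi, Matrix.one_apply] using this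
  obtain ⟨m, rfl⟩ := Nat.exists_eq_add_of_le hk
  have h1 : (X.submatrix (Fin.castLE hk) (Fin.castLE hk)) *ᵥ (v ∘ Fin.castLE hk) = 0 := by
    ext r
    have hr : ¬ lam (Fin.castLE hk r) < lam j := (hp _).mpr (by simp)
    have := congrFun hYv (Fin.castLE hk r)
    simp only [Matrix.mulVec, dotProduct, Ymat, Matrix.of_apply, hr, if_false] at this
    rw [Fin.sum_univ_add, Finset.sum_eq_zero (s := Finset.univ (α := Fin m)), add_zero] at this
    · exact this
    · intro a _
      rw [hv0 _ ?_, mul_zero]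
      by_contra hc
      have := (hp _).mp hc
      simp at this
  have h2 := Matrix.eq_zero_of_mulVec_eq_zero (hX k hk) h1
  apply hv
  ext i
  by_cases hi : lam i < lam j
  · exact hv0 i hi
  · have := (hp i).mp hi
    exact congrFun h2 ⟨i, this⟩

/-- Nonnegative orthogonal matrices. -/
def Good (n : ℕ) : Set (Matrix (Fin n) (Fin n) ℝ) := {g | gᵀ * g = 1 ∧ NonnegL g}

theorem UR_sub_Good (n : ℕ) : UR n ⊆ Good n := fun _ h => ⟨h.1, h.2.nonneg⟩

theorem det_ne_of_orth {n : ℕ} {g : Matrix (Fin n) (Fin n) ℝ} (h : gᵀ * g = 1) : g.det ≠ 0 := by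
  intro h0
  have := congrArg Matrix.det h
  rw [Matrix.det_mul, h0, mul_zero, Matrix.det_one] at this
  exact zero_ne_one this

theorem Good_Y {n : ℕ} (lam : Fin n → ℝ) (hl : Antitone lam) {S g : Matrix (Fin n) (Fin n) ℝ}
    (hS : PosL S) (hg : g ∈ Good n) (j : Fin n) : (Ymat lam (Sᵀ * g) j).det ≠ 0 :=
  Y_det_ne lam hl _ (fun _ hk => (leading_minor_pos hk S g hS hg.2 (det_ne_of_orth hg.1)).ne') j

noncomputable def nu {n : ℕ} (lam : Fin n → ℝ) (S g : Matrix (Fin n) (Fin n) ℝ) :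
    Matrix (Fin n) (Fin n) ℝ := chartN lam (Sᵀ * g)

theorem nu_unique {n : ℕ} {lam : Fin n → ℝ} (hl : Antitone lam) {S g N q : Matrix (Fin n) (Fin n) ℝ}
    (hS1 : Sᵀ * S = 1) (hS : PosL S) (hg : g ∈ Good n) (hN : Uni lam N) (hq : BU lam q)
    (h : S * N = g * q) : nu lam S g = N := by
  refine (chart_unique lam _ N q (Good_Y lam hl hS hg) hN hq ?_).symm
  rw [Matrix.mul_assoc, ← h, ← Matrix.mul_assoc, hS1, Matrix.one_mul]

theorem nu_exists {n : ℕ} {lam : Fin n → ℝ} (hl : Antitone lam) {S g : Matrix (Fin n) (Fin n) ℝ}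
    (hS1 : Sᵀ * S = 1) (hS : PosL S) (hg : g ∈ Good n) :
    ∃ q, BU lam q ∧ q.det ≠ 0 ∧ Uni lam (nu lam S g) ∧ S * nu lam S g = g * q := by
  obtain ⟨q, hq, hU, h⟩ := chart_exists lam (Sᵀ * g) (Good_Y lam hl hS hg)
  refine ⟨q, hq, ?_, hU, ?_⟩
  · intro h0
    have h1 := hU.det hl
    rw [h, Matrix.det_mul, h0, mul_zero] at h1
    exact zero_ne_one h1
  · unfold nu
    rw [h, ← Matrix.mul_assoc, ← Matrix.mul_assoc, mul_eq_one_comm.mp hS1, Matrix.one_mul]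

theorem nu_continuousOn {n : ℕ} {lam : Fin n → ℝ} (hl : Antitone lam) {S : Matrix (Fin n) (Fin n) ℝ}
    (hS : PosL S) : ContinuousOn (nu lam S) (Good n) := by
  have hX : Continuous fun g : Matrix (Fin n) (Fin n) ℝ => Sᵀ * g :=
    Continuous.matrix_mul continuous_const continuous_id
  have hY : ∀ j, Continuous fun g : Matrix (Fin n) (Fin n) ℝ => Ymat lam (Sᵀ * g) j := by
    intro j
    refine continuous_matrix fun i k => ?_
    simp only [Ymat, Matrix.of_apply]
    split_ifs
    · exact continuous_const
    · exact hX.matrix_elem i k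
  have hYi : ∀ j, ContinuousOn (fun g : Matrix (Fin n) (Fin n) ℝ => (Ymat lam (Sᵀ * g) j)⁻¹) (Good n) := by
    intro j
    have : (fun g : Matrix (Fin n) (Fin n) ℝ => (Ymat lam (Sᵀ * g) j)⁻¹) =
        fun g => ((Ymat lam (Sᵀ * g) j).det)⁻¹ • (Ymat lam (Sᵀ * g) j).adjugate := by
      funext g
      rw [Matrix.inv_def, Ring.inverse_eq_inv']
    rw [this]
    refine ContinuousOn.smul (ContinuousOn.inv₀ (hY j).matrix_det.continuousOn ?_) (hY j).matrix_adjugate.continuousOn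
    intro g hg
    exact Good_Y lam hl hS hg j
  refine continuousOn_pi.mpr fun i => continuousOn_pi.mpr fun j => ?_
  have : (fun g => nu lam S g i j) = fun g => ∑ k, (Sᵀ * g) i k * (Ymat lam (Sᵀ * g) j)⁻¹ k j := by
    funext g; simp [nu, chartN, Matrix.mul_apply]
  rw [this]
  refine continuousOn_finsetSum _ fun k _ => ?_
  refine (hX.matrix_elem i k).continuousOn.mul ?_
  exact (continuousOn_pi.mp (continuousOn_pi.mp (hYi j) k) j)

theorem comm_diag {n : ℕ} (lam : Fin n → ℝ) (u : Matrix (Fin n) (Fin n) ℝ) :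
    u * diagonal lam = diagonal lam * u ↔ ∀ i j, lam i ≠ lam j → u i j = 0 := by
  constructor
  · intro h i j hij
    have := congrFun (congrFun h i) j
    rw [Matrix.mul_diagonal, Matrix.diagonal_mul] at this
    have h2 : (lam j - lam i) * u i j = 0 := by linarith
    rcases mul_eq_zero.mp h2 with h3 | h3
    · exact absurd (by linarith) hij
    · exact h3
  · intro h
    ext i j
    rw [Matrix.mul_diagonal, Matrix.diagonal_mul]
    by_cases hij : lam i = lam j
    · rw [hij, mul_comm]
    · rw [h i j hij]; ring

theorem nu_iff {n : ℕ} {lam : Fin n → ℝ} (hl : Antitone lam) {S a b : Matrix (Fin n) (Fin n) ℝ}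
    (hS1 : Sᵀ * S = 1) (hS : PosL S) (ha : a ∈ Good n) (hb : b ∈ Good n) :
    a * diagonal lam * aᵀ = b * diagonal lam * bᵀ ↔ nu lam S a = nu lam S b := by
  have ha1 := ha.1
  have hb1 := hb.1
  have ha2 := mul_eq_one_comm.mp ha1
  have hb2 := mul_eq_one_comm.mp hb1
  have key : a * diagonal lam * aᵀ = b * diagonal lam * bᵀ ↔
      (aᵀ * b) * diagonal lam = diagonal lam * (aᵀ * b) := by
    constructor
    · intro h
      calc (aᵀ * b) * diagonal lam = aᵀ * (b * diagonal lam * bᵀ) * b := by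
            simp only [Matrix.mul_assoc]; rw [hb1, Matrix.mul_one]
        _ = aᵀ * (a * diagonal lam * aᵀ) * b := by rw [h]
        _ = (aᵀ * a) * diagonal lam * (aᵀ * b) := by simp only [Matrix.mul_assoc]
        _ = _ := by rw [ha1, Matrix.one_mul]
    · intro h
      calc a * diagonal lam * aᵀ = a * (diagonal lam * (aᵀ * b)) * bᵀ := by
            simp only [Matrix.mul_assoc]; rw [hb2, Matrix.mul_one]
        _ = a * ((aᵀ * b) * diagonal lam) * bᵀ := by rw [h]
        _ = (a * aᵀ) * (b * diagonal lam * bᵀ) := by simp only [Matrix.mul_assoc]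
        _ = _ := by rw [ha2, Matrix.one_mul]
  rw [key, comm_diag]
  obtain ⟨p, hp, hpd, hpU, hpE⟩ := nu_exists hl hS1 hS ha
  obtain ⟨q, hq, hqd, hqU, hqE⟩ := nu_exists hl hS1 hS hb
  constructor
  · intro h
    have hu : BU lam (aᵀ * b) := fun i j hij => h i j hij.ne
    refine nu_unique hl hS1 hS ha hqU (hu.mul hq) ?_
    rw [hqE, ← Matrix.mul_assoc, ← Matrix.mul_assoc, ha2, Matrix.one_mul]
  · intro h
    rw [h, hqE] at hpE
    have e1 : aᵀ * b = p * q⁻¹ := by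
      have : (aᵀ * b) * q = p := by
        rw [Matrix.mul_assoc, hpE, ← Matrix.mul_assoc, ha1, Matrix.one_mul]
      rw [← this, Matrix.mul_assoc, Matrix.mul_nonsing_inv _ (isUnit_iff_ne_zero.mpr hqd), Matrix.mul_one]
    have e2 : bᵀ * a = q * p⁻¹ := by
      have : (bᵀ * a) * p = q := by
        rw [Matrix.mul_assoc, ← hpE, ← Matrix.mul_assoc, hb1, Matrix.one_mul]
      rw [← this, Matrix.mul_assoc, Matrix.mul_nonsing_inv _ (isUnit_iff_ne_zero.mpr hpd), Matrix.mul_one]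
    intro i j hij
    rcases lt_or_gt_of_ne hij with h1 | h1
    · rw [e1]; exact (hp.mul (hq.inv hqd)) i j h1
    · have : (aᵀ * b) i j = (bᵀ * a) j i := by
        have : (aᵀ * b) = (bᵀ * a)ᵀ := by simp
        rw [this]; rfl
      rw [this, e2]; exact (hq.mul (hp.inv hpd)) j i h1


abbrev Idx {n : ℕ} (lam : Fin n → ℝ) : Type := {p : Fin n × Fin n // lam p.1 < lam p.2}

noncomputable def nuv {n : ℕ} (lam : Fin n → ℝ) (S g : Matrix (Fin n) (Fin n) ℝ) : Idx lam → ℝ :=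
  fun p => nu lam S g p.1.1 p.1.2

noncomputable def ofV {n : ℕ} (lam : Fin n → ℝ) (v : Idx lam → ℝ) : Matrix (Fin n) (Fin n) ℝ :=
  Matrix.of fun i j => if h : lam i < lam j then v ⟨(i, j), h⟩ else (1 : Matrix (Fin n) (Fin n) ℝ) i j

theorem ofV_uni {n : ℕ} (lam : Fin n → ℝ) (v : Idx lam → ℝ) : Uni lam (ofV lam v) := by
  intro i j hij
  simp [ofV, hij]

theorem ofV_nuv {n : ℕ} (lam : Fin n → ℝ) (S g : Matrix (Fin n) (Fin n) ℝ) (h : Uni lam (nu lam S g)) :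
    ofV lam (nuv lam S g) = nu lam S g := by
  ext i j
  by_cases hij : lam i < lam j
  · simp [ofV, hij, nuv]
  · rw [ofV_uni lam _ i j hij, h i j hij]

theorem nuv_ofV {n : ℕ} (lam : Fin n → ℝ) (S g : Matrix (Fin n) (Fin n) ℝ) (v : Idx lam → ℝ)
    (h : nu lam S g = ofV lam v) : nuv lam S g = v := by
  funext p
  have := p.2
  simp [nuv, h, ofV, this]

theorem ofV_continuous {n : ℕ} (lam : Fin n → ℝ) : Continuous (ofV lam) := by
  refine continuous_matrix fun i j => ?_
  simp only [ofV, Matrix.of_apply]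
  split_ifs with h
  · exact continuous_apply _
  · exact continuous_const

theorem isOpen_PosL (n : ℕ) : IsOpen {X : Matrix (Fin n) (Fin n) ℝ | PosL X} := by
  have : {X : Matrix (Fin n) (Fin n) ℝ | PosL X} =
      ⋂ k : Fin (n + 1), ⋂ f : Fin k → Fin n, ⋂ _ : StrictMono f,
        {X | 0 < (X.submatrix f (Fin.castLE (Nat.lt_succ_iff.mp k.2))).det} := by
    ext X
    simp only [Set.mem_ofPred_eq, Set.mem_iInter]
    exact ⟨fun h k f hf => h k _ f hf, fun h k hk f hf => h ⟨k, Nat.lt_succ_iff.mpr hk⟩ f hf⟩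
  rw [this]
  refine isOpen_iInter_of_finite fun k => isOpen_iInter_of_finite fun f => isOpen_iInter_of_finite fun _ => ?_
  exact isOpen_lt continuous_const (continuous_id.matrix_submatrix _ _).matrix_det

theorem isClosed_Good (n : ℕ) : IsClosed (Good n) := by
  have : Good n = {X | Xᵀ * X = 1} ∩ ⋂ k : ℕ, ⋂ h : k ≤ n, ⋂ f : Fin k → Fin n, ⋂ _ : StrictMono f,
        {X | 0 ≤ (X.submatrix f (Fin.castLE h)).det} := by
    ext X
    simp only [Good, NonnegL, Set.mem_ofPred_eq, Set.mem_iInter, Set.mem_inter_iff]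
  rw [this]
  refine IsClosed.inter ?_ (isClosed_iInter fun k => isClosed_iInter fun h => isClosed_iInter fun f => isClosed_iInter fun _ => ?_)
  · exact isClosed_eq (continuous_id.matrix_transpose.matrix_mul continuous_id) continuous_const
  · exact isClosed_le continuous_const (continuous_id.matrix_submatrix _ _).matrix_det

theorem isCompact_Good (n : ℕ) : IsCompact (Good n) := by
  have hc : IsCompact (Set.univ.pi fun _ : Fin n => Set.univ.pi fun _ : Fin n => Set.Icc (-1 : ℝ) 1) :=
    isCompact_univ_pi fun _ => isCompact_univ_pi fun _ => isCompact_Icc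
  refine IsCompact.of_isClosed_subset hc (isClosed_Good n) ?_
  intro g hg i _ j _
  have h1 : (gᵀ * g) j j = 1 := by rw [hg.1]; simp
  rw [Matrix.mul_apply] at h1
  have h2 : gᵀ j i * g i j ≤ ∑ k, gᵀ j k * g k j :=
    Finset.single_le_sum (f := fun k => gᵀ j k * g k j) (fun k _ => by
      simp only [Matrix.transpose_apply]; exact mul_self_nonneg _) (Finset.mem_univ i)
  rw [h1, Matrix.transpose_apply] at h2
  constructor <;> nlinarith

theorem flow_step {n : ℕ} {lam : Fin n → ℝ} (hl : Antitone lam) {S g : Matrix (Fin n) (Fin n) ℝ}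
    {μ : Fin n → ℝ} (hS1 : Sᵀ * S = 1) (hS : PosL S) (hM : pathM n * S = S * diagonal μ)
    (hg : g ∈ Good n) (t : ℝ) (ht : 0 < t) :
    ∃ g' ∈ UR n, ∀ p : Idx lam, nuv lam S g' p = Real.exp (t * (μ p.1.1 - μ p.1.2)) * nuv lam S g p := by
  have hA : PosL (flowE S μ t * g) := by
    intro k hk f hf
    have := flow_pos (flowE S μ) (flowE_zero S μ hS1) (flowE_deriv S μ hM) (g.submatrix id (Fin.castLE hk))
      (fun f hf => hg.2 k hk f hf) (exists_minor_ne_zero g (det_ne_of_orth hg.1) hk) t ht f hf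
    exact this
  obtain ⟨g', T, hg1, hg2, hAT, hT, hTd⟩ := qr _ hA
  have hg' : g' ∈ UR n := ⟨hg1, hg2⟩
  obtain ⟨q, hq, hqd, hqU, hqE⟩ := nu_exists hl hS1 hS hg
  refine ⟨g', hg', ?_⟩
  set N' : Matrix (Fin n) (Fin n) ℝ := diagonal (fun i => Real.exp (t * μ i)) * nu lam S g *
    diagonal (fun i => Real.exp (-(t * μ i))) with hN'
  have hN'e : ∀ i j, N' i j = Real.exp (t * μ i) * nu lam S g i j * Real.exp (-(t * μ j)) := by
    intro i j
    rw [hN', Matrix.mul_diagonal, Matrix.diagonal_mul]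
  have hU' : Uni lam N' := by
    intro i j hij
    rw [hN'e, hqU i j hij]
    by_cases h : i = j
    · subst h
      rw [Matrix.one_apply_eq, mul_one, ← Real.exp_add]; simp
    · rw [Matrix.one_apply_ne h]; simp
  have hdBU : BU lam (diagonal (fun i => Real.exp (-(t * μ i)))) := by
    intro i j hij
    exact Matrix.diagonal_apply_ne _ (by rintro rfl; exact lt_irrefl _ hij)
  have hnu : nu lam S g' = N' := by
    refine nu_unique hl hS1 hS (UR_sub_Good n hg') hU' (((BU_of_upper hl hT).mul hq).mul hdBU) ?_
    have e1 : S * diagonal (fun i => Real.exp (t * μ i)) = flowE S μ t * S := by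
      rw [flowE, Matrix.mul_assoc, hS1, Matrix.mul_one]
    calc S * N' = (S * diagonal (fun i => Real.exp (t * μ i))) * nu lam S g * diagonal (fun i => Real.exp (-(t * μ i))) := by
          rw [hN']; simp only [Matrix.mul_assoc]
      _ = flowE S μ t * (S * nu lam S g) * diagonal (fun i => Real.exp (-(t * μ i))) := by
          rw [e1]; simp only [Matrix.mul_assoc]
      _ = (flowE S μ t * g) * q * diagonal (fun i => Real.exp (-(t * μ i))) := by
          rw [hqE]; simp only [Matrix.mul_assoc]
      _ = _ := by rw [hAT]; simp only [Matrix.mul_assoc]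
  intro p
  simp only [nuv]
  rw [hnu, hN'e, mul_right_comm, ← Real.exp_add]
  congr 2
  ring

theorem isOpen_nuv_UR {n : ℕ} {lam : Fin n → ℝ} (hl : Antitone lam) {S : Matrix (Fin n) (Fin n) ℝ}
    (hS1 : Sᵀ * S = 1) (hS : PosL S) : IsOpen (nuv lam S '' UR n) := by
  rw [isOpen_iff_mem_nhds]
  rintro _ ⟨g, hg, rfl⟩
  obtain ⟨q, hq, hqd, hqU, hqE⟩ := nu_exists hl hS1 hS (UR_sub_Good n hg)
  have hc : Continuous fun v => S * ofV lam v * q⁻¹ :=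
    (continuous_const.matrix_mul (ofV_continuous lam)).matrix_mul continuous_const
  have hop := (isOpen_PosL n).preimage hc
  refine Filter.mem_of_superset (hop.mem_nhds ?_) ?_
  · change PosL (S * ofV lam (nuv lam S g) * q⁻¹)
    rw [ofV_nuv lam S g hqU, hqE, Matrix.mul_assoc, Matrix.mul_nonsing_inv _ (isUnit_iff_ne_zero.mpr hqd),
      Matrix.mul_one]
    exact hg.2
  · intro v hv
    obtain ⟨g', T, hg1, hg2, hAT, hT, hTd⟩ := qr _ hv
    refine ⟨g', ⟨hg1, hg2⟩, nuv_ofV lam S g' v ?_⟩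
    refine nu_unique hl hS1 hS (UR_sub_Good n ⟨hg1, hg2⟩) (ofV_uni lam v) ((BU_of_upper hl hT).mul hq) ?_
    rw [← Matrix.mul_assoc, ← hAT, Matrix.mul_assoc, Matrix.nonsing_inv_mul _ (isUnit_iff_ne_zero.mpr hqd),
      Matrix.mul_one]

theorem zero_mem_nuv {n : ℕ} {lam : Fin n → ℝ} (hl : Antitone lam) {S : Matrix (Fin n) (Fin n) ℝ}
    (hS1 : Sᵀ * S = 1) (hS : PosL S) : (0 : Idx lam → ℝ) ∈ nuv lam S '' UR n := by
  refine ⟨S, ⟨hS1, hS⟩, ?_⟩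
  have : nu lam S S = 1 := by
    refine nu_unique hl hS1 hS (UR_sub_Good n ⟨hS1, hS⟩) (q := 1) (fun _ _ _ => rfl) ?_ rfl
    intro i j hij
    exact Matrix.one_apply_ne (by rintro rfl; exact lt_irrefl _ hij)
  funext p
  simp only [nuv, this]
  exact Matrix.one_apply_ne (fun h => by have := p.2; rw [h] at this; exact lt_irrefl _ this)

noncomputable def piM {n : ℕ} (lam : Fin n → ℝ) (g : Matrix (Fin n) (Fin n) ℝ) : Matrix (Fin n) (Fin n) ℂ :=
  (g * diagonal lam * gᵀ).map Complex.ofReal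

theorem piM_iff {n : ℕ} {lam : Fin n → ℝ} (hl : Antitone lam) {S a b : Matrix (Fin n) (Fin n) ℝ}
    (hS1 : Sᵀ * S = 1) (hS : PosL S) (ha : a ∈ Good n) (hb : b ∈ Good n) :
    piM lam a = piM lam b ↔ nuv lam S a = nuv lam S b := by
  have h1 : piM lam a = piM lam b ↔ a * diagonal lam * aᵀ = b * diagonal lam * bᵀ :=
    ⟨fun h => Matrix.map_injective Complex.ofReal_injective h, fun h => congrArg (fun X => X.map Complex.ofReal) h⟩
  rw [h1, nu_iff hl hS1 hS ha hb]
  obtain ⟨_, _, _, hU1, _⟩ := nu_exists hl hS1 hS ha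
  obtain ⟨_, _, _, hU2, _⟩ := nu_exists hl hS1 hS hb
  constructor
  · intro h; funext p; simp [nuv, h]
  · intro h; rw [← ofV_nuv lam S a hU1, ← ofV_nuv lam S b hU2, h]

theorem piM_continuous {n : ℕ} (lam : Fin n → ℝ) : Continuous (piM lam) :=
  Continuous.matrix_map ((continuous_id.matrix_mul continuous_const).matrix_mul continuous_id.matrix_transpose)
    Complex.continuous_ofReal

theorem piM_image_UR {n : ℕ} (lam : Fin n → ℝ) : piM lam '' UR n = OrbitTP lam := by
  have key : ∀ g : Matrix (Fin n) (Fin n) ℝ, piM lam g =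
      g.map Complex.ofReal * Matrix.diagonal (fun i => (lam i : ℂ)) * (g.map Complex.ofReal)ᴴ := by
    intro g
    ext i j
    simp [piM, Matrix.mul_apply, Matrix.diagonal_apply]
  ext L
  simp only [OrbitTP, UnitaryTP_eq, Set.mem_image, Set.mem_ofPred_eq]
  constructor
  · rintro ⟨g, hg, rfl⟩
    exact ⟨_, ⟨g, hg, rfl⟩, key g⟩
  · rintro ⟨_, ⟨g, hg, rfl⟩, rfl⟩
    exact ⟨g, hg, key g⟩

theorem closure_UR_sub (n : ℕ) : closure (UR n) ⊆ Good n :=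
  closure_minimal (UR_sub_Good n) (isClosed_Good n)

theorem isCompact_closure_UR (n : ℕ) : IsCompact (closure (UR n)) :=
  (isCompact_Good n).of_isClosed_subset isClosed_closure (closure_UR_sub n)

theorem piM_image_closure {n : ℕ} (lam : Fin n → ℝ) : piM lam '' closure (UR n) = OrbitTNN lam := by
  rw [OrbitTNN, ← piM_image_UR]
  exact image_closure_of_isCompact (isCompact_closure_UR n) (piM_continuous lam).continuousOn

theorem nuv_continuousOn {n : ℕ} {lam : Fin n → ℝ} (hl : Antitone lam) {S : Matrix (Fin n) (Fin n) ℝ}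
    (hS : PosL S) : ContinuousOn (nuv lam S) (Good n) :=
  continuousOn_pi.mpr fun p => continuousOn_pi.mp (continuousOn_pi.mp (nu_continuousOn hl hS) p.1.1) p.1.2


theorem factor_cont {X Y Z : Type*} [TopologicalSpace X] [TopologicalSpace Y] [TopologicalSpace Z] [T2Space Y]
    (K : Set X) (hK : IsCompact K) (p : X → Y) (v : X → Z)
    (hp : ContinuousOn p K) (hv : ContinuousOn v K)
    (h : ∀ a ∈ K, ∀ b ∈ K, p a = p b → v a = v b) :
    ∃ f : ↥(p '' K) → ↥(v '' K), Continuous f ∧ ∀ a (ha : a ∈ K), f ⟨p a, a, ha, rfl⟩ = ⟨v a, a, ha, rfl⟩ := by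
  have hch : ∀ y : ↥(p '' K), ∃ a, a ∈ K ∧ p a = y := fun y => y.2
  choose c hcK hc using hch
  let f : ↥(p '' K) → ↥(v '' K) := fun y => ⟨v (c y), c y, hcK y, rfl⟩
  have hf : ∀ a (ha : a ∈ K), f ⟨p a, a, ha, rfl⟩ = ⟨v a, a, ha, rfl⟩ := by
    intro a ha
    exact Subtype.ext (h _ (hcK _) _ ha (hc _))
  refine ⟨f, ?_, hf⟩
  have : CompactSpace K := isCompact_iff_compactSpace.mp hK
  let p' : K → ↥(p '' K) := fun a => ⟨p a, a, a.2, rfl⟩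
  have hp' : Continuous p' := Continuous.subtype_mk (continuousOn_iff_continuous_domRestrict.mp hp) _
  have hq : Topology.IsQuotientMap p' := by
    refine hp'.isClosedMap.isQuotientMap hp' ?_
    rintro ⟨_, a, ha, rfl⟩
    exact ⟨⟨a, ha⟩, rfl⟩
  rw [hq.continuous_iff]
  have : f ∘ p' = fun a : K => ⟨v a, a, a.2, rfl⟩ := by
    funext a; exact hf a a.2
  rw [this]
  exact Continuous.subtype_mk (continuousOn_iff_continuous_domRestrict.mp hv) _

theorem homeo_images {X Y Z : Type*} [TopologicalSpace X] [TopologicalSpace Y] [TopologicalSpace Z] [T2Space Y]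
    [T2Space Z] (K : Set X) (hK : IsCompact K) (p : X → Y) (v : X → Z)
    (hp : ContinuousOn p K) (hv : ContinuousOn v K)
    (h : ∀ a ∈ K, ∀ b ∈ K, (p a = p b ↔ v a = v b)) :
    ∃ f : ↥(p '' K) ≃ₜ ↥(v '' K), ∀ a (ha : a ∈ K), f ⟨p a, a, ha, rfl⟩ = ⟨v a, a, ha, rfl⟩ := by
  obtain ⟨f, hf, hfe⟩ := factor_cont K hK p v hp hv fun a ha b hb => (h a ha b hb).mp
  obtain ⟨g, hg, hge⟩ := factor_cont K hK v p hv hp fun a ha b hb => (h a ha b hb).mpr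
  refine ⟨{ toFun := f, invFun := g, left_inv := ?_, right_inv := ?_, continuous_toFun := hf, continuous_invFun := hg }, hfe⟩
  · rintro ⟨_, a, ha, rfl⟩
    rw [hfe a ha, hge a ha]
  · rintro ⟨_, a, ha, rfl⟩
    rw [hge a ha, hfe a ha]

/-- signed power -/
noncomputable def sp (r x : ℝ) : ℝ := (max x 0) ^ r - (max (-x) 0) ^ r

theorem sp_nonneg {r x : ℝ} (hr : 0 < r) (hx : 0 ≤ x) : sp r x = x ^ r := by
  rw [sp, max_eq_left hx, max_eq_right (by linarith), Real.zero_rpow hr.ne', sub_zero]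

theorem sp_nonpos {r x : ℝ} (hr : 0 < r) (hx : x ≤ 0) : sp r x = -(-x) ^ r := by
  rw [sp, max_eq_right hx, max_eq_left (by linarith), Real.zero_rpow hr.ne', zero_sub]

theorem sp_cont {r : ℝ} (hr : 0 < r) : Continuous (sp r) := by
  unfold sp
  refine Continuous.sub ?_ ?_
  · exact (continuous_id.max continuous_const).rpow_const fun _ => Or.inr hr.le
  · exact (continuous_id.neg.max continuous_const).rpow_const fun _ => Or.inr hr.le

theorem sp_mul {r s : ℝ} (hr : 0 < r) (hs : 0 ≤ s) (x : ℝ) : sp r (s * x) = s ^ r * sp r x := by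
  rcases le_total 0 x with hx | hx
  · rw [sp_nonneg hr hx, sp_nonneg hr (mul_nonneg hs hx), Real.mul_rpow hs hx]
  · rw [sp_nonpos hr hx, sp_nonpos hr (mul_nonpos_of_nonneg_of_nonpos hs hx), ← mul_neg,
      Real.mul_rpow hs (by linarith)]
    ring

theorem sp_inv {r : ℝ} (hr : 0 < r) (x : ℝ) : sp r⁻¹ (sp r x) = x := by
  have hr' := inv_pos.mpr hr
  rcases le_total 0 x with hx | hx
  · rw [sp_nonneg hr hx, sp_nonneg hr' (Real.rpow_nonneg hx _), Real.rpow_rpow_inv hx hr.ne']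
  · have : 0 ≤ -x := by linarith
    rw [sp_nonpos hr hx, sp_nonpos hr' (neg_nonpos.mpr (Real.rpow_nonneg this _)), neg_neg,
      Real.rpow_rpow_inv this hr.ne', neg_neg]

noncomputable def spHomeo (r : ℝ) (hr : 0 < r) : ℝ ≃ₜ ℝ where
  toFun := sp r
  invFun := sp r⁻¹
  left_inv := sp_inv hr
  right_inv := fun x => by
    have := sp_inv (inv_pos.mpr hr) x
    rwa [inv_inv] at this
  continuous_toFun := sp_cont hr
  continuous_invFun := sp_cont (inv_pos.mpr hr)

theorem star_homeo {E : Type*} [NormedAddCommGroup E] [NormedSpace ℝ E] (P Q : Set E) (hQ : IsCompact Q)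
    (hP : IsOpen P) (hPQ : P ⊆ Q) (h0 : (0 : E) ∈ P)
    (hst : ∀ s : ℝ, 0 < s → s < 1 → ∀ x ∈ Q, s • x ∈ P) :
    ∃ F : ↥Q ≃ₜ ↥(Metric.closedBall (0 : E) 1), ∀ x : ↥Q, ((x : E) ∈ P ↔ (F x : E) ∈ Metric.ball (0 : E) 1) := by
  have hnh : Q ∈ nhds (0 : E) := Filter.mem_of_superset (hP.mem_nhds h0) hPQ
  have hab : Absorbent ℝ Q := absorbent_nhds_zero hnh
  have habP : Absorbent ℝ P := absorbent_nhds_zero (hP.mem_nhds h0)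
  have hbd : Bornology.IsVonNBounded ℝ Q := NormedSpace.isVonNBounded_of_isBounded ℝ hQ.isBounded
  have hlt : ∀ x, gauge Q x < 1 ↔ x ∈ P := by
    intro x
    constructor
    · intro h
      obtain ⟨b, hb0, hb1, hx⟩ := exists_lt_of_gauge_lt hab h
      obtain ⟨y, hy, rfl⟩ := hx
      exact hst b hb0 hb1 y hy
    · intro h
      exact lt_of_le_of_lt (gauge_mono habP hPQ x) (gauge_lt_one_of_mem_of_isOpen hP h)
  have hle : ∀ x, gauge Q x ≤ 1 ↔ x ∈ Q := by
    intro x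
    constructor
    · intro h
      have hlim : Filter.Tendsto (fun s : ℝ => s • x) (nhdsWithin 1 (Set.Iio 1)) (nhds ((1 : ℝ) • x)) :=
        ((continuous_id.smul continuous_const).tendsto 1).mono_left nhdsWithin_le_nhds
      rw [one_smul] at hlim
      refine hQ.isClosed.mem_of_tendsto hlim ?_
      have : Set.Ioo (0 : ℝ) 1 ∈ nhdsWithin (1 : ℝ) (Set.Iio 1) := Ioo_mem_nhdsLT (by norm_num)
      filter_upwards [this] with s hs
      refine hPQ ((hlt _).mp ?_)
      rw [gauge_smul_of_nonneg hs.1.le, smul_eq_mul]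
      nlinarith [hs.1, hs.2, gauge_nonneg (s := Q) x]
    · intro h
      exact gauge_le_one_of_mem h
  have hpos : ∀ x, x ≠ 0 → 0 < gauge Q x := fun x hx => (gauge_pos hab hbd).mpr hx
  have hcont : Continuous (gauge Q) := by
    rw [continuous_iff_lower_upperSemicontinuous]
    constructor
    · rw [lowerSemicontinuous_iff_isClosed_preimage]
      intro a
      rcases lt_trichotomy a 0 with ha | ha | ha
      · have : gauge Q ⁻¹' Set.Iic a = ∅ := by
          ext x
          simp only [Set.mem_preimage, Set.mem_Iic, Set.mem_empty_iff_false, iff_false, not_le]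
          exact lt_of_lt_of_le ha (gauge_nonneg x)
        rw [this]; exact isClosed_empty
      · have : gauge Q ⁻¹' Set.Iic a = {0} := by
          ext x
          simp only [Set.mem_preimage, Set.mem_Iic, Set.mem_singleton_iff, ha]
          constructor
          · intro h; by_contra hx; exact absurd (hpos x hx) (not_lt.mpr h)
          · rintro rfl; rw [gauge_zero]
        rw [this]; exact isClosed_singleton
      · have : gauge Q ⁻¹' Set.Iic a = (fun x => a⁻¹ • x) ⁻¹' Q := by
          ext x
          simp only [Set.mem_preimage, Set.mem_Iic]
          rw [← hle, gauge_smul_of_nonneg (inv_nonneg.mpr ha.le), smul_eq_mul, inv_mul_le_iff₀ ha, mul_one]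
        rw [this]; exact hQ.isClosed.preimage (continuous_const_smul _)
    · rw [upperSemicontinuous_iff_isOpen_preimage]
      intro a
      rcases le_or_gt a 0 with ha | ha
      · have : gauge Q ⁻¹' Set.Iio a = ∅ := by
          ext x
          simp only [Set.mem_preimage, Set.mem_Iio, Set.mem_empty_iff_false, iff_false, not_lt]
          exact ha.trans (gauge_nonneg x)
        rw [this]; exact isOpen_empty
      · have : gauge Q ⁻¹' Set.Iio a = (fun x => a⁻¹ • x) ⁻¹' P := by
          ext x
          simp only [Set.mem_preimage, Set.mem_Iio]
          rw [← hlt, gauge_smul_of_nonneg (inv_nonneg.mpr ha.le), smul_eq_mul, inv_mul_lt_iff₀ ha, mul_one]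
        rw [this]; exact hP.preimage (continuous_const_smul _)
  let f : E → E := fun x => (gauge Q x / ‖x‖) • x
  have hfn : ∀ x, ‖f x‖ = gauge Q x := by
    intro x
    by_cases hx : x = 0
    · simp [f, hx]
    · have : ‖x‖ ≠ 0 := norm_ne_zero_iff.mpr hx
      simp only [f]
      rw [norm_smul, Real.norm_of_nonneg (div_nonneg (gauge_nonneg x) (norm_nonneg x)), div_mul_cancel₀ _ this]
  have hf : Continuous f := by
    rw [continuous_iff_continuousAt]
    intro x
    by_cases hx : x = 0
    · subst hx
      have hf0 : f 0 = 0 := by simp [f]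
      rw [ContinuousAt, hf0, tendsto_zero_iff_norm_tendsto_zero]
      simp only [hfn]
      have := hcont.tendsto 0
      rwa [gauge_zero] at this
    · exact ContinuousAt.smul (hcont.continuousAt.div continuous_norm.continuousAt (norm_ne_zero_iff.mpr hx))
        continuousAt_id
  have hinj : Function.Injective f := by
    intro x y hxy
    have hg : gauge Q x = gauge Q y := by rw [← hfn, ← hfn, hxy]
    by_cases hx : x = 0
    · subst hx
      rw [gauge_zero] at hg
      by_contra hy
      exact absurd (hpos y (Ne.symm hy)) (by rw [← hg]; exact lt_irrefl _)
    · have hgx := hpos x hx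
      have hy : y ≠ 0 := by
        rintro rfl
        rw [hg, gauge_zero] at hgx; exact lt_irrefl _ hgx
      have hnx := norm_pos_iff.mpr hx
      have hny := norm_pos_iff.mpr hy
      simp only [f] at hxy
      rw [← hg, div_eq_mul_inv, div_eq_mul_inv, mul_smul, mul_smul] at hxy
      have h1 : ‖x‖⁻¹ • x = ‖y‖⁻¹ • y := smul_right_injective E hgx.ne' hxy
      have h2 : x = (‖x‖ * ‖y‖⁻¹) • y := by
        rw [mul_smul, ← h1, smul_smul, mul_inv_cancel₀ hnx.ne', one_smul]
      have h3 : gauge Q x = (‖x‖ * ‖y‖⁻¹) * gauge Q y := by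
        conv_lhs => rw [h2]
        rw [gauge_smul_of_nonneg (by positivity), smul_eq_mul]
      rw [← hg] at h3
      have h4 : ‖x‖ * ‖y‖⁻¹ = 1 := by
        have : (‖x‖ * ‖y‖⁻¹ - 1) * gauge Q x = 0 := by linarith
        rcases mul_eq_zero.mp this with h | h
        · linarith
        · exact absurd h hgx.ne'
      rw [h2, h4, one_smul]
  have : CompactSpace Q := isCompact_iff_compactSpace.mp hQ
  let F : ↥Q → ↥(Metric.closedBall (0 : E) 1) := fun x => ⟨f x, by
    rw [mem_closedBall_zero_iff, hfn]; exact (hle _).mpr x.2⟩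
  have hF : Continuous F := Continuous.subtype_mk (hf.comp continuous_subtype_val) _
  have hbij : Function.Bijective F := by
    constructor
    · intro x y hxy
      exact Subtype.ext (hinj (congrArg Subtype.val hxy))
    · rintro ⟨y, hy⟩
      rw [mem_closedBall_zero_iff] at hy
      by_cases hy0 : y = 0
      · refine ⟨⟨0, hPQ h0⟩, Subtype.ext ?_⟩
        simp [F, f, hy0]
      · have hgy := hpos y hy0
        have hny := norm_pos_iff.mpr hy0
        have hgx : gauge Q ((‖y‖ / gauge Q y) • y) = ‖y‖ := by
          rw [gauge_smul_of_nonneg (by positivity), smul_eq_mul, div_mul_cancel₀ _ hgy.ne']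
        refine ⟨⟨(‖y‖ / gauge Q y) • y, (hle _).mp (by rw [hgx]; exact hy)⟩, Subtype.ext ?_⟩
        simp only [F, f]
        rw [hgx, norm_smul, Real.norm_of_nonneg (by positivity), smul_smul]
        have : ‖y‖ / (‖y‖ / gauge Q y * ‖y‖) * (‖y‖ / gauge Q y) = 1 := by
          field_simp
        rw [this, one_smul]
  refine ⟨hF.homeoOfEquivCompactToT2 (f := Equiv.ofBijective F hbij), fun x => ?_⟩
  change (x : E) ∈ P ↔ f x ∈ Metric.ball (0 : E) 1
  rw [mem_ball_zero_iff, hfn, hlt]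


theorem card_Idx {n d : ℕ} (lam : Fin n → ℝ)
    (hd : 2 * d + (Finset.univ.filter fun p : Fin n × Fin n => lam p.1 = lam p.2).card
      = n * n) : Fintype.card (Idx lam) = d := by
  classical
  rw [Fintype.card_subtype]
  have h1 : (Finset.univ.filter fun p : Fin n × Fin n => lam p.1 < lam p.2).card =
      (Finset.univ.filter fun p : Fin n × Fin n => lam p.2 < lam p.1).card := by
    refine Finset.card_bij (fun p _ => p.swap) ?_ ?_ ?_
    · intro p hp; simpa using hp
    · intro p _ q _ h; exact Prod.swap_injective h
    · intro p hp; exact ⟨p.swap, by simpa using hp, by simp⟩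
  have h2 : (Finset.univ.filter fun p : Fin n × Fin n => lam p.1 = lam p.2).card +
      ((Finset.univ.filter fun p : Fin n × Fin n => lam p.1 < lam p.2).card +
      (Finset.univ.filter fun p : Fin n × Fin n => lam p.2 < lam p.1).card) = n * n := by
    have hsplit := Finset.card_filter_add_card_filter_not (s := (Finset.univ : Finset (Fin n × Fin n)))
      (fun p => lam p.1 = lam p.2)
    rw [← Finset.card_union_of_disjoint]
    · rw [Finset.card_univ, Fintype.card_prod, Fintype.card_fin] at hsplit
      rw [← hsplit]
      congr 2
      ext p
      simp [lt_or_lt_iff_ne]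
    · rw [Finset.disjoint_filter]
      intro p _ h; exact not_lt.mpr h.le
  omega

theorem restrict_homeo {X Y : Type*} [TopologicalSpace X] [TopologicalSpace Y] {A A' : Set X} {B B' : Set Y}
    (F : ↥A ≃ₜ ↥B) (hA : A' ⊆ A) (hB : B' ⊆ B) (h : ∀ x : ↥A, (x : X) ∈ A' ↔ (F x : Y) ∈ B') :
    Nonempty (↥A' ≃ₜ ↥B') := by
  refine ⟨{
    toFun := fun a => ⟨F ⟨a, hA a.2⟩, (h _).mp a.2⟩
    invFun := fun b => ⟨F.symm ⟨b, hB b.2⟩, (h _).mpr (by rw [F.apply_symm_apply]; exact b.2)⟩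
    left_inv := fun a => by simp
    right_inv := fun b => by simp
    continuous_toFun := ?_
    continuous_invFun := ?_ }⟩
  · exact Continuous.subtype_mk (continuous_subtype_val.comp (F.continuous.comp
      (Continuous.subtype_mk continuous_subtype_val _))) _
  · exact Continuous.subtype_mk (continuous_subtype_val.comp (F.symm.continuous.comp
      (Continuous.subtype_mk continuous_subtype_val _))) _

theorem main_homeo {n d : ℕ} (lam : Fin n → ℝ)
    (hanti : Antitone lam)
    (hd : 2 * d + (Finset.univ.filter fun p : Fin n × Fin n => lam p.1 = lam p.2).card
      = n * n) :
    (∃ F : ↥(OrbitTNN lam) ≃ₜ ↥(Metric.closedBall (0 : EuclideanSpace ℝ (Fin d)) 1),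
      ∀ L : ↥(OrbitTNN lam), ((L : Matrix (Fin n) (Fin n) ℂ) ∈ OrbitTP lam ↔
        (F L : EuclideanSpace ℝ (Fin d)) ∈ Metric.ball (0 : EuclideanSpace ℝ (Fin d)) 1)) := by
  obtain ⟨S, μ, hS1, hμ, hM, hS⟩ := spectral_pos n
  have hc : ∀ p : Idx lam, 0 < μ p.1.2 - μ p.1.1 := by
    intro p
    have h1 : p.1.2 < p.1.1 := by
      by_contra h
      exact absurd (hanti (not_lt.mp h)) (not_le.mpr p.2)
    have := hμ h1
    linarith
  let e : (Idx lam → ℝ) ≃L[ℝ] EuclideanSpace ℝ (Fin d) :=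
    ContinuousLinearEquiv.ofFinrankEq (by
      rw [Module.finrank_fintype_fun_eq_card, card_Idx lam hd, finrank_euclideanSpace_fin])
  let Ψ : (Idx lam → ℝ) ≃ₜ EuclideanSpace ℝ (Fin d) :=
    (Homeomorph.piCongrRight fun p : Idx lam => spHomeo (μ p.1.2 - μ p.1.1)⁻¹ (inv_pos.mpr (hc p))).trans
      e.toHomeomorph
  have hΨ : ∀ v, Ψ v = e (fun p => sp (μ p.1.2 - μ p.1.1)⁻¹ (v p)) := fun v => rfl
  let w : Matrix (Fin n) (Fin n) ℝ → EuclideanSpace ℝ (Fin d) := fun g => Ψ (nuv lam S g)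
  have hK := isCompact_closure_UR n
  have hwc : ContinuousOn w (closure (UR n)) :=
    Ψ.continuous.comp_continuousOn ((nuv_continuousOn hanti hS).mono (closure_UR_sub n))
  have hiff : ∀ a ∈ closure (UR n), ∀ b ∈ closure (UR n), (piM lam a = piM lam b ↔ w a = w b) := by
    intro a ha b hb
    rw [piM_iff hanti hS1 hS (closure_UR_sub n ha) (closure_UR_sub n hb)]
    exact Ψ.injective.eq_iff.symm
  obtain ⟨f, hf⟩ := homeo_images (closure (UR n)) hK (piM lam) w (piM_continuous lam).continuousOn hwc hiff
  have hPo : IsOpen (w '' UR n) := by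
    have : w '' UR n = Ψ '' (nuv lam S '' UR n) := by rw [Set.image_image]
    rw [this]
    exact Ψ.isOpenMap _ (isOpen_nuv_UR hanti hS1 hS)
  have hP0 : (0 : EuclideanSpace ℝ (Fin d)) ∈ w '' UR n := by
    obtain ⟨g, hg, hg0⟩ := zero_mem_nuv hanti hS1 hS
    refine ⟨g, hg, ?_⟩
    change Ψ (nuv lam S g) = 0
    rw [hg0, hΨ]
    have : (fun p : Idx lam => sp (μ p.1.2 - μ p.1.1)⁻¹ ((0 : Idx lam → ℝ) p)) = 0 := by
      funext p
      simp [sp]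
    rw [this, map_zero]
  have hst : ∀ s : ℝ, 0 < s → s < 1 → ∀ x ∈ w '' closure (UR n), s • x ∈ w '' UR n := by
    rintro s hs0 hs1 _ ⟨g, hg, rfl⟩
    obtain ⟨g', hg', hg'e⟩ := flow_step hanti hS1 hS hM (closure_UR_sub n hg) (-Real.log s)
      (neg_pos.mpr (Real.log_neg hs0 hs1))
    refine ⟨g', hg', ?_⟩
    change Ψ (nuv lam S g') = s • Ψ (nuv lam S g)
    rw [hΨ, hΨ, ← map_smul]
    congr 1
    funext p
    rw [hg'e, Pi.smul_apply, smul_eq_mul]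
    have h1 : Real.exp (-Real.log s * (μ p.1.1 - μ p.1.2)) = s ^ (μ p.1.2 - μ p.1.1) := by
      rw [Real.rpow_def_of_pos hs0]; congr 1; ring
    rw [h1, sp_mul (inv_pos.mpr (hc p)) (Real.rpow_nonneg hs0.le _), Real.rpow_rpow_inv hs0.le (hc p).ne']
  obtain ⟨G, hG⟩ := star_homeo (w '' UR n) (w '' closure (UR n)) (hK.image_of_continuousOn hwc) hPo
    (Set.image_mono subset_closure) hP0 hst
  refine ⟨(Homeomorph.setCongr (piM_image_closure lam).symm).trans (f.trans G), ?_⟩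
  rintro ⟨L, hL⟩
  have hL' := hL
  rw [← piM_image_closure] at hL'
  obtain ⟨a, ha, rfl⟩ := hL'
  have h1 : ((Homeomorph.setCongr (piM_image_closure lam).symm).trans (f.trans G)) ⟨piM lam a, hL⟩ =
      G ⟨w a, a, ha, rfl⟩ := by
    rw [← hf a ha]; rfl
  rw [h1, ← hG, ← piM_image_UR]
  constructor
  · rintro ⟨b, hb, hba⟩
    exact ⟨b, hb, (hiff b (subset_closure hb) a ha).mp hba⟩
  · rintro ⟨b, hb, hba⟩
    exact ⟨b, hb, (hiff b (subset_closure hb) a ha).mpr hba⟩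

/-- Let `λ ∈ ℝⁿ` be weakly decreasing and let `d` be half of
`n² − Σⱼ mⱼ²` where the `mⱼ` are the multiplicities of the distinct values of `λ`
(equivalently, `2d + #{(i,j) : λᵢ = λⱼ} = n²`). Then `O_λ^{≥0}` is homeomorphic to the
closed unit ball of `ℝ^d` by a homeomorphism carrying `O_λ^{>0}` onto the open unit
ball; consequently `O_λ^{>0}` is homeomorphic to an open `d`-ball and, when `λ` is
nonconstant, the boundary `O_λ^{≥0} ∖ O_λ^{>0}` is homeomorphic to the sphere
`S^{d−1}`. -/
theorem tnn_orbit_homeomorphic_closed_ball {n d : ℕ} (lam : Fin n → ℝ)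
    (hanti : Antitone lam)
    (hd : 2 * d + (Finset.univ.filter fun p : Fin n × Fin n => lam p.1 = lam p.2).card
      = n * n) :
    (∃ F : ↥(OrbitTNN lam) ≃ₜ ↥(Metric.closedBall (0 : EuclideanSpace ℝ (Fin d)) 1),
      ∀ L : ↥(OrbitTNN lam), ((L : Matrix (Fin n) (Fin n) ℂ) ∈ OrbitTP lam ↔
        (F L : EuclideanSpace ℝ (Fin d)) ∈ Metric.ball (0 : EuclideanSpace ℝ (Fin d)) 1)) ∧
    Nonempty (↥(OrbitTP lam) ≃ₜ ↥(Metric.ball (0 : EuclideanSpace ℝ (Fin d)) 1)) ∧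
    ((∃ a b : Fin n, lam a ≠ lam b) →
      Nonempty (↥(OrbitTNN lam \ OrbitTP lam) ≃ₜ
        ↥(Metric.sphere (0 : EuclideanSpace ℝ (Fin d)) 1))) := by
  obtain ⟨F, hF⟩ := main_homeo lam hanti hd
  refine ⟨⟨F, hF⟩, restrict_homeo F subset_closure Metric.ball_subset_closedBall hF, fun _ => ?_⟩
  refine restrict_homeo F Set.diff_subset Metric.sphere_subset_closedBall fun x => ?_
  have h1 := hF x
  have h2 := (F x).2
  rw [← Metric.closedBall_diff_ball, Set.mem_diff, Set.mem_diff]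
  exact ⟨fun h => ⟨h2, fun hb => h.2 (h1.mpr hb)⟩, fun h => ⟨x.2, fun hb => h.2 (h1.mp hb)⟩⟩
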